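/- arXiv:1706.08330 — 2 statements merged into one kernel-verified Lean document; each statement's English description precedes it below -/
import Mathlib

section
/- Every locally finite connected graph with linear growth and countably infinite automorphism group has exactly 2 ends. -/
open Set Cardinal

namespace PaperEnds

/-- A ray in `G`: a one-sided infinite path, i.e. an injective sequence of
pairwise adjacent consecutive vertices. -/
def IsRay {V : Type} (G : SimpleGraph V) (r : ℕ → V) : Prop :=
  Function.Injective r ∧ ∀ n, G.Adj (r n) (r (n + 1))

/-- `a` and `b` are connected by a walk avoiding the vertex set `S`. -/
def ReachableOutside {V : Type} (G : SimpleGraph V) (S : Set V) (a b : V) : Prop :=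
  ∃ w : G.Walk a b, ∀ v ∈ w.support, v ∉ S

/-- Two rays are equivalent (belong to the same end) if for every finite vertex
set `S` they have tails lying in the same component of `G − S`. -/
def RayEquiv {V : Type} (G : SimpleGraph V) (r₁ r₂ : ℕ → V) : Prop :=
  ∀ S : Set V, S.Finite → ∃ m n : ℕ,
    (∀ i, m ≤ i → r₁ i ∉ S) ∧ (∀ j, n ≤ j → r₂ j ∉ S) ∧
    ReachableOutside G S (r₁ m) (r₂ n)

/-- `r` is a ray belonging to the end represented by the ray `ω`. -/
def InEnd {V : Type} (G : SimpleGraph V) (ω r : ℕ → V) : Prop :=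
  IsRay G r ∧ RayEquiv G r ω

/-- `G` has exactly one end: it has a ray and any two rays are equivalent. -/
def OneEnded {V : Type} (G : SimpleGraph V) : Prop :=
  (∃ r, IsRay G r) ∧ ∀ r₁ r₂, IsRay G r₁ → IsRay G r₂ → RayEquiv G r₁ r₂

/-- A family of pairwise (vertex-)disjoint rays. -/
def DisjointRays {V : Type} {ι : Type} (f : ι → ℕ → V) : Prop :=
  Pairwise fun i j => Disjoint (Set.range (f i)) (Set.range (f j))

/-- The end represented by `ω` has vertex degree `k`: the maximum cardinality of a
family of pairwise disjoint rays belonging to the end is `k`. -/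
def EndVertexDegree {V : Type} (G : SimpleGraph V) (ω : ℕ → V) (k : ℕ) : Prop :=
  (∃ f : Fin k → ℕ → V, (∀ i, InEnd G ω (f i)) ∧ DisjointRays f) ∧
  ¬ ∃ f : Fin (k + 1) → ℕ → V, (∀ i, InEnd G ω (f i)) ∧ DisjointRays f

/-- `v` dominates the end represented by `ω`: for every ray `r` in the end there are
infinitely many `v`–`r` paths pairwise meeting only in `v`. -/
def Dominates {V : Type} (G : SimpleGraph V) (v : V) (ω : ℕ → V) : Prop :=
  ∀ r : ℕ → V, InEnd G ω r →
    ∃ (t : ℕ → ℕ) (P : (n : ℕ) → G.Walk v (r (t n))),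
      Function.Injective t ∧
      (∀ n, (P n).IsPath) ∧
      (∀ n, ∀ u ∈ (P n).support, u ∈ Set.range r → u = r (t n)) ∧
      (∀ m n, m ≠ n → ∀ u, u ∈ (P m).support → u ∈ (P n).support → u = v)

/-- The end represented by `ω` is undominated. -/
def Undominated {V : Type} (G : SimpleGraph V) (ω : ℕ → V) : Prop :=
  ¬ ∃ v, Dominates G v ω

/-- `(A, B)` is a separation of `G`. -/
def IsSeparation {V : Type} (G : SimpleGraph V) (A B : Set V) : Prop :=
  A ∪ B = Set.univ ∧ ∀ a ∈ A \ B, ∀ b ∈ B \ A, ¬ G.Adj a b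

/-- The order of a separation `(A, B)`, i.e. `|A ∩ B|` as an extended natural number. -/
noncomputable def SepOrder {V : Type} (A B : Set V) : ℕ∞ := (A ∩ B).encard

/-- The end represented by `ω` lies in the side `B`: every ray of the end has all
but finitely many vertices in `B`. -/
def LiesIn {V : Type} (G : SimpleGraph V) (ω : ℕ → V) (B : Set V) : Prop :=
  ∀ r, InEnd G ω r → ∃ m, ∀ n, m ≤ n → r n ∈ B

/-- The vertex set `s` is connected in `G` (any two of its vertices are joined by a
walk inside `s`). -/
def ConnectedIn {V : Type} (G : SimpleGraph V) (s : Set V) : Prop :=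
  ∀ a ∈ s, ∀ b ∈ s, ∃ w : G.Walk a b, ∀ v ∈ w.support, v ∈ s

/-- `(A, B)` is an ω-relevant separation (for the end of vertex degree `k`
represented by the ray `ω`). -/
def Relevant {V : Type} (G : SimpleGraph V) (ω : ℕ → V) (k : ℕ) (A B : Set V) : Prop :=
  IsSeparation G A B ∧ SepOrder A B = (k : ℕ∞) ∧
  ConnectedIn G (A \ B) ∧
  (∀ v ∈ A ∩ B, ∃ u ∈ A \ B, G.Adj v u) ∧
  LiesIn G ω B ∧
  ¬ ∃ C D : Set V, IsSeparation G C D ∧ SepOrder C D < (k : ℕ∞) ∧ A ⊆ C ∧ LiesIn G ω D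

/-- Two separations `(A, B)` and `(C, D)` are nested. -/
def Nested {V : Type} (A B C D : Set V) : Prop :=
  (A ⊆ C ∧ D ⊆ B) ∨ (A ⊆ D ∧ C ⊆ B) ∨ (B ⊆ C ∧ D ⊆ A) ∨ (B ⊆ D ∧ C ⊆ A)

section Words

set_option linter.unusedSectionVars false

variable {Γ : Type} [Group Γ] {ι : Type} [LinearOrder ι]

def wProd (e : ι → Γ) (w : List ι) : Γ := (w.map e).prod

lemma wProd_append (e : ι → Γ) (a b : List ι) : wProd e (a ++ b) = wProd e a * wProd e b := by
  simp [wProd]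

lemma lex_append_same {s t : List ι} (h : List.Lex (· < ·) s t) (hl : s.length = t.length)
    (b : List ι) : List.Lex (· < ·) (s ++ b) (t ++ b) := by
  induction h with
  | nil => simp at hl
  | cons h ih =>
    simp only [List.cons_append]
    exact List.Lex.cons (ih (by simpa using hl))
  | rel h => exact List.Lex.rel h

lemma shortlex_append_same {s t : List ι} (h : List.Shortlex (· < ·) s t) (b : List ι) :
    List.Shortlex (· < ·) (s ++ b) (t ++ b) := by
  rcases List.shortlex_def.1 h with h | ⟨h1, h2⟩
  · exact List.Shortlex.of_length_lt (by simpa using h)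
  · exact List.Shortlex.of_lex (by simpa using h1) (lex_append_same h2 h1 b)

/-- shortlex-minimal words -/
def MinWord (e : ι → Γ) (w : List ι) : Prop :=
  ∀ w', wProd e w' = wProd e w → ¬ List.Shortlex (· < ·) w' w

lemma MinWord.left {e : ι → Γ} {a b : List ι} (h : MinWord e (a ++ b)) : MinWord e a := by
  intro w' hw hs
  exact h (w' ++ b) (by simp [wProd_append, hw]) (shortlex_append_same hs b)

lemma MinWord.right {e : ι → Γ} {a b : List ι} (h : MinWord e (a ++ b)) : MinWord e b := by
  intro w' hw hs
  exact h (a ++ w') (by simp [wProd_append, hw]) (List.Shortlex.append_left hs a)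

lemma MinWord.inj {e : ι → Γ} {a b : List ι} (ha : MinWord e a) (hb : MinWord e b)
    (h : wProd e a = wProd e b) : a = b := by
  have := (inferInstance : Std.Trichotomous (List.Shortlex (α := ι) (· < ·))).trichotomous a b
  exact this (hb a h) (ha b h.symm)

lemma exists_minWord [Finite ι] (e : ι → Γ) (w : List ι) :
    ∃ w', MinWord e w' ∧ wProd e w' = wProd e w := by
  have wf : WellFounded (List.Shortlex (α := ι) (· < ·)) :=
    List.Shortlex.wf (Finite.to_wellFoundedLT (α := ι)).wf
  obtain ⟨m, hm, hmin⟩ := wf.has_min {w' | wProd e w' = wProd e w} ⟨w, rfl⟩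
  refine ⟨m, fun w' hw' hs => hmin w' ?_ hs, hm⟩
  simp only [Set.mem_ofPred_eq] at *
  rw [hw', hm]

def fac (x : ℕ → ι) (i n : ℕ) : List ι := (List.range n).map (fun t => x (i + t))

lemma fac_length (x : ℕ → ι) (i n : ℕ) : (fac x i n).length = n := by simp [fac]

lemma fac_add (x : ℕ → ι) (i m n : ℕ) : fac x i (m + n) = fac x i m ++ fac x (i + m) n := by
  simp [fac, List.range_add, Function.comp_def, add_assoc]

lemma fac_one (x : ℕ → ι) (i : ℕ) : fac x i 1 = [x i] := by simp [fac]

lemma exists_infinite_word [Finite ι] (e : ι → Γ)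
    (hinf : (Set.range (wProd e)).Infinite) :
    ∃ x : ℕ → ι, ∀ i n, MinWord e (fac x i n) := by
  let ext : List ι → Set (List ι) := fun w => {w' | MinWord e w' ∧ w <+: w'}
  have h0 : (ext []).Infinite := by
    intro hf
    apply hinf
    refine (hf.image (wProd e)).subset ?_
    rintro _ ⟨w, rfl⟩
    obtain ⟨w', h1, h2⟩ := exists_minWord e w
    exact ⟨w', ⟨h1, List.nil_prefix⟩, h2⟩
  have hs : ∀ w, (ext w).Infinite → ∃ a, (ext (w ++ [a])).Infinite := by
    intro w hw
    by_contra! hcon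
    apply hw
    have : (ext w) ⊆ {w} ∪ ⋃ a, ext (w ++ [a]) := by
      rintro w' ⟨h1, t, rfl⟩
      cases t with
      | nil => left; simp
      | cons a t =>
        right
        refine Set.mem_iUnion.2 ⟨a, h1, t, by simp⟩
    exact ((Set.finite_singleton w).union
      (Set.finite_iUnion fun a => hcon a)).subset this
  have : Nonempty ι := ⟨(hs [] h0).choose⟩
  choose! f hf using hs
  let W : ℕ → List ι := fun n => Nat.rec [] (fun _ w => w ++ [f w]) n
  have hW : ∀ n, (ext (W n)).Infinite := by
    intro n
    induction n with
    | zero => exact h0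
    | succ n ih => exact hf _ ih
  have hW' : ∀ n, fac (fun n => f (W n)) 0 n = W n := by
    intro n
    induction n with
    | zero => rfl
    | succ n ih => rw [fac_add, ih, fac_one]; simp [W]
  refine ⟨fun n => f (W n), fun i n => ?_⟩
  have h1 : MinWord e (fac (fun n => f (W n)) 0 (i + n)) := by
    rw [hW']
    obtain ⟨w', h1, t, rfl⟩ := (hW (i + n)).nonempty
    exact h1.left
  rw [fac_add] at h1
  simpa using h1.right

lemma exists_infinite_order [Finite ι] (e : ι → Γ)
    (hinf : (Set.range (wProd e)).Infinite) (C : ℕ)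
    (hC : ∀ N, 1 ≤ N → (wProd e '' {w | w.length ≤ N}).ncard ≤ C * N) :
    ∃ g : Γ, ∀ k, 1 ≤ k → g ^ k ≠ 1 := by
  obtain ⟨x, hx⟩ := exists_infinite_word e hinf
  let Fac : ℕ → Set (List ι) := fun n => Set.range (fun i => fac x i n)
  have hfin : ∀ n, (Fac n).Finite := by
    intro n
    refine (List.finite_length_eq ι n).subset ?_
    rintro _ ⟨i, rfl⟩
    exact fac_length x i n
  have hfinN : ∀ N, {w : List ι | w.length ≤ N}.Finite := fun N => List.finite_length_le ι N
  -- some m with p (m+1) ≤ p m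
  have hm : ∃ m, (Fac (m + 1)).ncard ≤ (Fac m).ncard := by
    by_contra! hcon
    have hp : ∀ m, m + 1 ≤ (Fac m).ncard := by
      intro m
      induction m with
      | zero =>
        have : (Fac 0).Nonempty := ⟨_, 0, rfl⟩
        have := (Set.ncard_pos (hfin 0)).2 this
        omega
      | succ m ih => have := hcon m; omega
    let Q : ℕ → Set (List ι) := fun N => {w | ∃ n ≤ N, w ∈ Fac n}
    have hQsub : ∀ N, Q N ⊆ {w : List ι | w.length ≤ N} := by
      rintro N _ ⟨n, hn, i, rfl⟩
      simpa [fac_length] using hn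
    have hQmin : ∀ N, ∀ w ∈ Q N, MinWord e w := by
      rintro N _ ⟨n, hn, i, rfl⟩
      exact hx i n
    have hQ : ∀ N, N * N ≤ 2 * (Q N).ncard := by
      intro N
      induction N with
      | zero => simp
      | succ N ih =>
        have h1 : Q (N + 1) = Q N ∪ Fac (N + 1) := by
          ext w
          constructor
          · rintro ⟨n, hn, hw⟩
            rcases Nat.lt_or_ge N n with h | h
            · right
              have : n = N + 1 := by omega
              exact this ▸ hw
            · left; exact ⟨n, h, hw⟩
          · rintro (⟨n, hn, hw⟩ | hw)
            · exact ⟨n, by omega, hw⟩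
            · exact ⟨N + 1, le_rfl, hw⟩
        have h2 : Disjoint (Q N) (Fac (N + 1)) := by
          rw [Set.disjoint_left]
          rintro w hw ⟨i, rfl⟩
          have := hQsub N hw
          simp [fac_length] at this
        rw [h1, Set.ncard_union_eq h2 ((hfinN N).subset (hQsub N)) (hfin _)]
        have := hp (N + 1)
        nlinarith
    have hle : ∀ N, 1 ≤ N → (Q N).ncard ≤ C * N := by
      intro N hN
      rw [← Set.InjOn.ncard_image (f := wProd e) (s := Q N)
        (fun a ha b hb h => (hQmin N a ha).inj (hQmin N b hb) h)]
      exact (Set.ncard_le_ncard (Set.image_mono (hQsub N)) ((hfinN N).image _)).trans (hC N hN)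
    have h1 := hQ (2 * C + 1)
    have h2 := hle (2 * C + 1) (by omega)
    nlinarith
  obtain ⟨m, hm⟩ := hm
  have hdet : ∀ i j, fac x i m = fac x j m → fac x i (m + 1) = fac x j (m + 1) := by
    have hinj : Set.InjOn (fun w : List ι => w.take m) (Fac (m + 1)) := by
      have himg : (fun w : List ι => w.take m) '' (Fac (m + 1)) = Fac m := by
        have key : ∀ i, (fac x i (m + 1)).take m = fac x i m := by
          intro i
          rw [fac_add, List.take_left' (fac_length x i m)]
        ext w
        constructor
        · rintro ⟨_, ⟨i, rfl⟩, rfl⟩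
          exact ⟨i, (key i).symm⟩
        · rintro ⟨i, rfl⟩
          exact ⟨_, ⟨i, rfl⟩, key i⟩
      apply Set.injOn_of_ncard_image_eq _ (hfin _)
      rw [himg]
      apply le_antisymm _ hm
      rw [← himg]
      exact Set.ncard_image_le (hfin _)
    intro i j h
    apply hinj ⟨i, rfl⟩ ⟨j, rfl⟩
    simp only
    rw [fac_add, fac_add, List.take_left' (fac_length x i m), List.take_left' (fac_length x j m), h]
  obtain ⟨i, j, hij, h⟩ : ∃ i j, i < j ∧ fac x i m = fac x j m := by
    obtain ⟨i, -, j, -, hne, h⟩ := Set.infinite_univ.exists_ne_map_eq_of_mapsTo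
      (f := fun i => fac x i m) (t := Fac m) (fun i _ => ⟨i, rfl⟩) (hfin m)
    rcases lt_or_gt_of_ne hne with h' | h'
    · exact ⟨i, j, h', h⟩
    · exact ⟨j, i, h', h.symm⟩
  have hall : ∀ t, fac x (i + t) m = fac x (j + t) m := by
    intro t
    induction t with
    | zero => exact h
    | succ t ih =>
      have := hdet _ _ ih
      rw [add_comm m 1, fac_add, fac_add, fac_one, fac_one] at this
      simp at this
      simpa [add_assoc] using this.2
  have hper : ∀ t, x (i + t) = x (j + t) := by
    intro t
    have := hdet _ _ (hall t)
    rw [add_comm m 1, fac_add, fac_add, fac_one, fac_one] at this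
    simp at this
    exact this.1
  obtain ⟨d, rfl⟩ := Nat.exists_eq_add_of_lt hij
  have hfacper : ∀ k, fac x (i + k * (d + 1)) (d + 1) = fac x i (d + 1) := by
    intro k
    induction k with
    | zero => simp
    | succ k ih =>
      rw [← ih]
      unfold fac
      apply List.map_congr_left
      intro t _
      rw [show i + k * (d + 1) + t = i + (k * (d + 1) + t) by ring, hper]
      congr 1
      ring
  have hpow : ∀ k, wProd e (fac x i (k * (d + 1))) = wProd e (fac x i (d + 1)) ^ k := by
    intro k
    induction k with
    | zero => simp [fac, wProd]
    | succ k ih => rw [add_mul, one_mul, fac_add, wProd_append, ih, hfacper, pow_succ]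
  refine ⟨wProd e (fac x i (d + 1)), fun k hk hk1 => ?_⟩
  rw [← hpow] at hk1
  refine hx i (k * (d + 1)) [] (by rw [hk1]; simp [wProd]) ?_
  apply List.Shortlex.of_length_lt
  rw [fac_length]
  simp only [List.length_nil]
  positivity

end Words
section Base

/-- A locally finite countable graph with countable automorphism group has a finite base. -/
lemma exists_finite_base {V : Type} [Countable V] (G : SimpleGraph V)
    [Countable (G ≃g G)] :
    ∃ F : Set V, F.Finite ∧ ∀ φ : G ≃g G, (∀ v ∈ F, φ v = v) → φ = 1 := by
  let : TopologicalSpace V := ⊥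
  have : DiscreteTopology V := ⟨rfl⟩
  let K : Set ((V → V) × (V → V)) := {p | (∀ v, p.1 (p.2 v) = v) ∧ (∀ v, p.2 (p.1 v) = v) ∧
    ∀ a b, G.Adj (p.1 a) (p.1 b) ↔ G.Adj a b}
  have hK : IsClosed K := by
    have e1 : ∀ v, IsClosed {p : (V → V) × (V → V) | p.1 (p.2 v) = v} := by
      intro v
      have hc : Continuous (fun p : (V → V) × (V → V) => p.1 (p.2 v)) := by
        have : Continuous (fun q : (V → V) × V => q.1 q.2) := by
          rw [continuous_iff_continuousAt]
          rintro ⟨f, w⟩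
          have hev : (fun q : (V → V) × V => q.1 q.2) =ᶠ[nhds (f, w)] fun q => q.1 w := by
            have : {q : (V → V) × V | q.2 = w} ∈ nhds (f, w) :=
              (isOpen_discrete ({w} : Set V)).preimage continuous_snd |>.mem_nhds rfl
            filter_upwards [this] with q hq
            rw [hq]
          refine ContinuousAt.congr ?_ hev.symm
          exact ((continuous_apply w).comp continuous_fst).continuousAt
        exact this.comp (continuous_fst.prodMk ((continuous_apply v).comp continuous_snd))
      exact (isClosed_discrete ({v} : Set V)).preimage hc
    have e2 : ∀ v, IsClosed {p : (V → V) × (V → V) | p.2 (p.1 v) = v} := fun v =>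
      (e1 v).preimage continuous_swap
    have e3 : ∀ a b, IsClosed {p : (V → V) × (V → V) | G.Adj (p.1 a) (p.1 b) ↔ G.Adj a b} := by
      intro a b
      have hc : Continuous (fun p : (V → V) × (V → V) => (p.1 a, p.1 b)) :=
        ((continuous_apply a).comp continuous_fst).prodMk ((continuous_apply b).comp continuous_fst)
      exact (isClosed_discrete {q : V × V | G.Adj q.1 q.2 ↔ G.Adj a b}).preimage hc
    have : K = (⋂ v, {p | p.1 (p.2 v) = v}) ∩ ((⋂ v, {p | p.2 (p.1 v) = v}) ∩
        ⋂ a, ⋂ b, {p | G.Adj (p.1 a) (p.1 b) ↔ G.Adj a b}) := by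
      ext p; simp [K]
    rw [this]
    exact (isClosed_iInter e1).inter ((isClosed_iInter e2).inter
      (isClosed_iInter fun a => isClosed_iInter fun b => e3 a b))
  let toK : (G ≃g G) → K := fun φ => ⟨(φ, φ.symm),
    fun v => φ.apply_symm_apply v, fun v => φ.symm_apply_apply v, fun _ _ => φ.map_rel_iff⟩
  have hsurj : ∀ k : K, ∃ φ, toK φ = k := by
    rintro ⟨⟨f, f'⟩, h1, h2, h3⟩
    exact ⟨⟨⟨f, f', h2, h1⟩, h3 _ _⟩, rfl⟩
  have : TopologicalSpace.IsCompletelyMetrizableSpace K := hK.isCompletelyMetrizableSpace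
  have : Nonempty K := ⟨toK 1⟩
  obtain ⟨φ, hφ⟩ := nonempty_interior_of_iUnion_of_closed (f := fun φ => {toK φ})
    (fun φ => isClosed_singleton) (by
      ext k
      obtain ⟨φ, rfl⟩ := hsurj k
      simp)
  have hopen : IsOpen ({toK φ} : Set K) := by
    obtain ⟨k, hk⟩ := hφ
    have h1 := interior_subset hk
    have : interior {toK φ} = ({toK φ} : Set K) := by
      apply Set.Subset.antisymm interior_subset
      rintro _ rfl
      rw [Set.mem_singleton_iff] at h1
      rw [h1] at hk
      exact hk
    rw [← this]; exact isOpen_interior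
  obtain ⟨U, hU, hUeq⟩ := isOpen_induced_iff.1 hopen
  have hmem : ((φ : V → V), (φ.symm : V → V)) ∈ U := by
    have : toK φ ∈ (Subtype.val ⁻¹' U : Set K) := by rw [hUeq]; rfl
    exact this
  obtain ⟨U1, U2, hU1, hU2, hm1, hm2, hsub⟩ := isOpen_prod_iff.1 hU _ _ hmem
  obtain ⟨I, u, hu, hIsub⟩ := isOpen_pi_iff.1 hU1 _ hm1
  obtain ⟨J, u', hu', hJsub⟩ := isOpen_pi_iff.1 hU2 _ hm2
  refine ⟨(I : Set V) ∪ (fun v => φ.symm v) '' (J : Set V),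
    I.finite_toSet.union (J.finite_toSet.image _), fun ψ hψ => ?_⟩
  have h1 : toK (φ * ψ) ∈ (Subtype.val ⁻¹' U : Set K) := by
    apply hsub
    constructor
    · apply hIsub
      intro v hv
      have : ψ v = v := hψ v (Or.inl hv)
      change φ (ψ v) ∈ _
      rw [this]
      exact (hu v hv).2
    · apply hJsub
      intro v hv
      have : ψ (φ.symm v) = φ.symm v := hψ _ (Or.inr ⟨v, hv, rfl⟩)
      change ψ.symm (φ.symm v) ∈ _
      rw [← this, RelIso.symm_apply_apply]
      exact (hu' v hv).2
  rw [hUeq, Set.mem_singleton_iff] at h1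
  have h2 : φ * ψ = φ := by
    ext v
    exact congrFun (congrArg (fun k : K => k.1.1) h1) v
  simpa using h2

end Base
section GraphPart

variable {V : Type} {G : SimpleGraph V}

lemma iso_dist_le (hconn : G.Connected) (φ : G ≃g G) (a b : V) :
    G.dist (φ a) (φ b) ≤ G.dist a b := by
  obtain ⟨p, hp⟩ := hconn.exists_walk_length_eq_dist a b
  rw [← hp]
  have := SimpleGraph.dist_le (p.map φ.toHom)
  rwa [SimpleGraph.Walk.length_map] at this

lemma iso_dist (hconn : G.Connected) (φ : G ≃g G) (a b : V) :
    G.dist (φ a) (φ b) = G.dist a b := by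
  apply le_antisymm (iso_dist_le hconn φ a b)
  have := iso_dist_le hconn φ⁻¹ (φ a) (φ b)
  simpa using this

lemma ball_finite (hconn : G.Connected) (hlf : ∀ v : V, (G.neighborSet v).Finite) (v : V) (n : ℕ) :
    {u : V | G.dist v u ≤ n}.Finite := by
  induction n with
  | zero =>
    refine (Set.finite_singleton v).subset ?_
    intro u hu
    have : G.dist v u = 0 := Nat.le_zero.1 hu
    exact ((hconn.dist_eq_zero_iff).1 this).symm
  | succ n ih =>
    refine (ih.union (ih.biUnion fun x _ => hlf x)).subset ?_
    intro u hu
    obtain ⟨p, hp⟩ := hconn.exists_walk_length_eq_dist u v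
    have hu' : G.dist u v ≤ n + 1 := by rw [SimpleGraph.dist_comm]; exact hu
    cases p with
    | nil => left; simp
    | @cons _ x _ hadj q =>
      right
      simp only [SimpleGraph.Walk.length_cons] at hp
      have h1 := SimpleGraph.dist_le q
      refine Set.mem_iUnion₂.2 ⟨x, ?_, hadj.symm⟩
      change G.dist v x ≤ n
      rw [SimpleGraph.dist_comm]
      omega

lemma move_finite (hconn : G.Connected) (hlf : ∀ v : V, (G.neighborSet v).Finite)
    {F : Set V} (hF : F.Finite) (hbase : ∀ φ : G ≃g G, (∀ v ∈ F, φ v = v) → φ = 1) (a b : V) :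
    {φ : G ≃g G | φ a = b}.Finite := by
  have : Finite F := hF
  have hfin : {f : F → V | ∀ x : F, f x ∈ {u : V | G.dist b u ≤ G.dist a x.1}}.Finite :=
    Set.Finite.pi' fun x => ball_finite hconn hlf b _
  refine Set.Finite.of_finite_image (f := fun φ (x : F) => φ x) (hfin.subset ?_) ?_
  · rintro _ ⟨φ, hφ, rfl⟩ x
    change G.dist b (φ x) ≤ _
    have hφ' : φ a = b := hφ
    rw [← hφ', iso_dist hconn]
  · intro φ _ ψ _ h
    have : ψ⁻¹ * φ = 1 := by
      apply hbase
      intro v hv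
      have h1 : φ v = ψ v := congrFun h ⟨v, hv⟩
      rw [RelIso.mul_apply, h1, RelIso.inv_apply_self]
    exact (inv_mul_eq_one.1 this).symm

lemma no_finite_support [Infinite (G ≃g G)]
    (hmove : ∀ a b : V, {φ : G ≃g G | φ a = b}.Finite)
    {F : Set V} (hF : F.Finite) (hbase : ∀ φ : G ≃g G, (∀ v ∈ F, φ v = v) → φ = 1)
    (ψ : G ≃g G) (hψ : {v | ψ v ≠ v}.Finite) : ψ = 1 := by
  have hbad : (⋃ s ∈ {v | ψ v ≠ v}, ⋃ f ∈ F, {g : G ≃g G | g s = f}).Finite :=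
    hψ.biUnion fun s _ => hF.biUnion fun f _ => hmove s f
  obtain ⟨g, hg⟩ := hbad.exists_notMem
  have h1 : g * ψ * g⁻¹ = 1 := by
    apply hbase
    intro f hf
    have h2 : ψ (g⁻¹ f) = g⁻¹ f := by
      by_contra hne
      apply hg
      refine Set.mem_iUnion₂.2 ⟨g⁻¹ f, hne, Set.mem_iUnion₂.2 ⟨f, hf, ?_⟩⟩
      exact RelIso.apply_inv_self g f
    rw [RelIso.mul_apply, RelIso.mul_apply, h2, RelIso.apply_inv_self]
  have h2 : g * ψ = g := mul_inv_eq_one.1 h1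
  simpa using h2

lemma glue_fix (hns : ∀ ψ : G ≃g G, {v | ψ v ≠ v}.Finite → ψ = 1)
    {A : Set V} (hA : A.Finite) (φ : G ≃g G) (hφA : ∀ a, φ a ∈ A ↔ a ∈ A)
    (hbd : ∀ a ∈ A, ∀ b, b ∉ A → G.Adj a b → φ a = a) : ∀ a ∈ A, φ a = a := by
  classical
  have hinvA : ∀ a, φ.symm a ∈ A ↔ a ∈ A := by
    intro a
    rw [← hφA, RelIso.apply_symm_apply]
  let e : V ≃ V :=
    { toFun := fun a => if a ∈ A then φ a else a
      invFun := fun a => if a ∈ A then φ.symm a else a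
      left_inv := by
        intro a
        by_cases h : a ∈ A
        · simp [h, hφA]
        · simp [h]
      right_inv := by
        intro a
        by_cases h : a ∈ A
        · simp [h, hinvA]
        · simp [h] }
  have he1 : ∀ a ∈ A, e a = φ a := fun a ha => if_pos ha
  have he2 : ∀ a, a ∉ A → e a = a := fun a ha => if_neg ha
  have hcross : ∀ a ∈ A, ∀ b, b ∉ A → (G.Adj (φ a) b ↔ G.Adj a b) := by
    intro a ha b hb
    constructor
    · intro h
      have h1 := hbd (φ a) ((hφA a).2 ha) b hb h
      have h2 : φ a = a := φ.injective h1
      rwa [h2] at h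
    · intro h
      rwa [hbd a ha b hb h]
  let ψ : G ≃g G :=
    { e with
      map_rel_iff' := by
        intro a b
        by_cases ha : a ∈ A <;> by_cases hb : b ∈ A
        · rw [he1 a ha, he1 b hb]; exact φ.map_rel_iff
        · rw [he1 a ha, he2 b hb]; exact hcross a ha b hb
        · rw [he2 a ha, he1 b hb, G.adj_comm, hcross b hb a ha, G.adj_comm]
        · rw [he2 a ha, he2 b hb] }
  have hψ : ψ = 1 := by
    apply hns
    refine hA.subset ?_
    intro v hv
    by_contra hvA
    exact hv (he2 v hvA)
  intro a ha
  have h1 : ψ a = a := by rw [hψ]; rfl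
  rw [← he1 a ha]
  exact h1

lemma finite_subgroup_bound (hconn : G.Connected) (hlf : ∀ v : V, (G.neighborSet v).Finite)
    (hns : ∀ ψ : G ≃g G, {v | ψ v ≠ v}.Finite → ψ = 1)
    {F : Set V} (hF : F.Finite) (hbase : ∀ φ : G ≃g G, (∀ v ∈ F, φ v = v) → φ = 1)
    (v : V) (c : ℕ) (hg : ∀ n : ℕ, 1 ≤ n → {u : V | G.dist v u ≤ n}.ncard ≤ c * n)
    (H : Subgroup (G ≃g G)) [Finite H] : Nat.card H ≤ (c + 1) ^ (c + 1) := by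
  let W : ℕ → Set V := fun n => {u | ∃ h ∈ H, G.dist (h v) u ≤ n}
  obtain ⟨D, hD⟩ : ∃ D, ∀ h ∈ H, G.dist v (h v) ≤ D := by
    obtain ⟨D, hD⟩ := (Set.finite_range (fun h : H => G.dist v (h.1 v))).bddAbove
    exact ⟨D, fun h hh => hD ⟨⟨h, hh⟩, rfl⟩⟩
  obtain ⟨R, hR⟩ : ∃ R, ∀ f ∈ F, G.dist v f ≤ R := by
    obtain ⟨D, hD⟩ := (hF.image (fun f => G.dist v f)).bddAbove
    exact ⟨D, fun h hh => hD ⟨h, hh, rfl⟩⟩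
  have hWsub : ∀ n, W n ⊆ {u | G.dist v u ≤ n + D} := by
    rintro n u ⟨h, hh, hd⟩
    have h1 := hconn.dist_triangle (u := v) (v := h v) (w := u)
    have h2 := hD h hh
    change G.dist v u ≤ n + D
    omega
  have hWfin : ∀ n, (W n).Finite := fun n => (ball_finite hconn hlf v (n + D)).subset (hWsub n)
  have hWmono : ∀ n, W n ⊆ W (n + 1) := by
    rintro n u ⟨h, hh, hd⟩
    exact ⟨h, hh, by omega⟩
  have hWinv : ∀ n, ∀ φ ∈ H, ∀ a, φ a ∈ W n ↔ a ∈ W n := by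
    intro n φ hφ a
    constructor
    · rintro ⟨h, hh, hd⟩
      refine ⟨φ⁻¹ * h, H.mul_mem (H.inv_mem hφ) hh, ?_⟩
      have := iso_dist hconn φ ((φ⁻¹ * h) v) a
      rw [RelIso.mul_apply, RelIso.apply_inv_self] at this
      rw [RelIso.mul_apply]
      omega
    · rintro ⟨h, hh, hd⟩
      refine ⟨φ * h, H.mul_mem hφ hh, ?_⟩
      rw [RelIso.mul_apply, iso_dist hconn]
      exact hd
  obtain ⟨n, hnR, hn⟩ : ∃ n, R ≤ n ∧ (W (n + 1) \ W n).ncard ≤ c := by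
    by_contra! hcon
    have hlow : ∀ j, (c + 1) * j ≤ (W (R + j)).ncard := by
      intro j
      induction j with
      | zero => simp
      | succ j ih =>
        have h1 := hcon (R + j) (by omega)
        have h2 := Set.ncard_sdiff_add_ncard_of_subset (hWmono (R + j)) (hWfin _)
        have h3 : W (R + (j + 1)) = W (R + j + 1) := rfl
        rw [h3, ← h2]
        nlinarith
    let j := c * (R + D) + 1
    have h1 := hlow j
    have h2 := Set.ncard_le_ncard (hWsub (R + j)) (ball_finite hconn hlf v _)
    have h3 := hg (R + j + D) (by omega)
    have h4 : (c + 1) * j ≤ c * (R + j + D) := h1.trans (h2.trans h3)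
    have h5 : c * (R + j + D) = c * (R + D) + c * j := by ring
    have h6 : (c + 1) * j = c * j + (c * (R + D) + 1) := by rw [add_mul, one_mul]
    omega
  let T : Set V := W (n + 1) \ W n
  have hTfin : Finite T := (hWfin (n + 1)).subset Set.sdiff_subset
  have hTinv : ∀ φ ∈ H, ∀ a ∈ T, φ a ∈ T := by
    intro φ hφ a ha
    exact ⟨(hWinv _ φ hφ a).2 ha.1, fun h => ha.2 ((hWinv _ φ hφ a).1 h)⟩
  have hfaith : ∀ φ ∈ H, (∀ a ∈ T, φ a = a) → φ = 1 := by
    intro φ hφ hfix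
    have h1 := glue_fix hns (hWfin (n + 1)) φ (hWinv _ φ hφ) (by
      intro a ha b hb hab
      apply hfix a
      refine ⟨ha, ?_⟩
      rintro ⟨h, hh, hd⟩
      apply hb
      refine ⟨h, hh, ?_⟩
      have h1 := hconn.dist_triangle (u := h v) (v := a) (w := b)
      have h2 := SimpleGraph.dist_eq_one_iff_adj.2 hab
      omega)
    apply hbase
    intro f hf
    apply h1
    refine ⟨1, H.one_mem, ?_⟩
    have := hR f hf
    change G.dist v f ≤ _
    omega
  let act : H → (T → T) := fun φ a => ⟨φ.1 a.1, hTinv φ.1 φ.2 a.1 a.2⟩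
  have hact : Function.Injective act := by
    intro φ ψ h
    have h1 : ψ.1⁻¹ * φ.1 = 1 := by
      apply hfaith _ (H.mul_mem (H.inv_mem ψ.2) φ.2)
      intro a ha
      have h2 : φ.1 a = ψ.1 a := congrArg Subtype.val (congrFun h ⟨a, ha⟩)
      rw [RelIso.mul_apply, h2, RelIso.inv_apply_self]
    exact Subtype.ext (inv_mul_eq_one.1 h1).symm
  have h1 := Nat.card_le_card_of_injective act hact
  rw [Nat.card_fun] at h1
  have h2 : Nat.card T ≤ c := hn
  calc Nat.card H ≤ _ := h1
    _ ≤ (c + 1) ^ (Nat.card T) := Nat.pow_le_pow_left (by omega) _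
    _ ≤ _ := Nat.pow_le_pow_right (by omega) (by omega)

lemma exists_hyperbolic [Infinite (G ≃g G)] (hconn : G.Connected)
    (hlf : ∀ v : V, (G.neighborSet v).Finite)
    (hmove : ∀ a b : V, {φ : G ≃g G | φ a = b}.Finite)
    (v : V) (c : ℕ) (hg : ∀ n : ℕ, 1 ≤ n → {u : V | G.dist v u ≤ n}.ncard ≤ c * n)
    (M : ℕ) (hM : ∀ H : Subgroup (G ≃g G), Finite H → Nat.card H ≤ M) :
    ∃ g : G ≃g G, ∀ k, 1 ≤ k → g ^ k ≠ 1 := by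
  classical
  obtain ⟨E, hE⟩ := Infinite.exists_subset_card_eq (G ≃g G) (M + 1)
  let E' : Finset (G ≃g G) := E ∪ E.image (fun g => g⁻¹)
  let e : Fin (E'.card) → (G ≃g G) := fun i => (E'.equivFin.symm i).1
  have he : ∀ g ∈ E', ∃ i, e i = g := by
    intro g hg
    exact ⟨E'.equivFin ⟨g, hg⟩, by simp [e]⟩
  have hrange : ((Subgroup.closure (E : Set (G ≃g G)) : Subgroup _) : Set (G ≃g G)) ⊆
      Set.range (wProd e) := by
    intro g hg
    rw [SetLike.mem_coe, ← Subgroup.mem_toSubmonoid, Subgroup.closure_toSubmonoid] at hg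
    obtain ⟨l, hl, rfl⟩ := Submonoid.exists_list_of_mem_closure hg
    clear hg
    induction l with
    | nil => exact ⟨[], rfl⟩
    | cons a l ih =>
      obtain ⟨w, hw⟩ := ih (fun y hy => hl y (List.mem_cons_of_mem _ hy))
      obtain ⟨i, hi⟩ := he a (by
        rcases hl a List.mem_cons_self with h | h
        · exact Finset.mem_union_left _ h
        · exact Finset.mem_union_right _ (Finset.mem_image.2 ⟨a⁻¹, h, inv_inv a⟩))
      refine ⟨i :: w, ?_⟩
      rw [List.prod_cons, ← hw, ← hi]
      simp [wProd]
  have hinf : (Set.range (wProd e)).Infinite := by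
    intro hfin
    have hf : (((Subgroup.closure (E : Set (G ≃g G)) : Subgroup _) : Set (G ≃g G))).Finite :=
      hfin.subset hrange
    have h1 := hM _ hf
    have h2 := Set.ncard_le_ncard (Subgroup.subset_closure (k := (E : Set (G ≃g G)))) hf
    rw [Set.ncard_coe_finset, hE] at h2
    have h3 : ((Subgroup.closure (E : Set (G ≃g G)) : Subgroup _) : Set (G ≃g G)).ncard ≤ M := h1
    omega
  obtain ⟨ℓ, hℓ⟩ : ∃ ℓ, ∀ i, G.dist v (e i v) ≤ ℓ := by
    obtain ⟨D, hD⟩ := (Set.finite_range (fun i => G.dist v (e i v))).bddAbove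
    exact ⟨D, fun i => hD ⟨i, rfl⟩⟩
  have hlen : ∀ w : List (Fin E'.card), G.dist v (wProd e w v) ≤ ℓ * w.length := by
    intro w
    induction w with
    | nil => simp [wProd]
    | cons i w ih =>
      have h0 : wProd e (i :: w) v = e i (wProd e w v) := by
        simp [wProd]
      have h1 := hconn.dist_triangle (u := v) (v := e i v) (w := e i (wProd e w v))
      rw [iso_dist hconn] at h1
      have h2 := hℓ i
      rw [h0, List.length_cons, mul_add]
      omega
  let s := {φ : G ≃g G | φ v = v}.ncard
  have hcount : ∀ n, {φ : G ≃g G | G.dist v (φ v) ≤ n}.Finite ∧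
      {φ : G ≃g G | G.dist v (φ v) ≤ n}.ncard ≤ s * {u | G.dist v u ≤ n}.ncard := by
    intro n
    have hb := ball_finite hconn hlf v n
    have hfin : {φ : G ≃g G | G.dist v (φ v) ≤ n}.Finite := by
      refine (hb.biUnion fun u _ => hmove v u).subset ?_
      intro φ hφ
      exact Set.mem_iUnion₂.2 ⟨φ v, hφ, rfl⟩
    refine ⟨hfin, ?_⟩
    rw [Set.ncard_eq_toFinset_card _ hfin, Set.ncard_eq_toFinset_card _ hb]
    have h1 := Finset.card_le_mul_card_image (f := fun φ : G ≃g G => φ v) hfin.toFinset s (by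
      intro b hb
      obtain ⟨φ₀, -, hφ₀⟩ := Finset.mem_image.1 hb
      rw [← Set.ncard_coe_finset]
      apply Set.ncard_le_ncard_of_injOn (fun φ => φ₀⁻¹ * φ) (ht := hmove v v)
      · intro φ hφ
        have h2 : φ v = b := (Finset.mem_filter.1 hφ).2
        change φ₀⁻¹ (φ v) = v
        rw [h2, ← hφ₀, RelIso.inv_apply_self]
      · intro a _ b _ h
        exact mul_left_cancel h)
    refine h1.trans (Nat.mul_le_mul_left _ (Finset.card_le_card ?_))
    intro u hu
    obtain ⟨φ, hφ, rfl⟩ := Finset.mem_image.1 hu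
    simpa using hφ
  refine exists_infinite_order e hinf (s * (c * (ℓ + 1))) ?_
  intro N hN
  have hsub : wProd e '' {w | w.length ≤ N} ⊆
      {φ : G ≃g G | G.dist v (φ v) ≤ (ℓ + 1) * N} := by
    rintro _ ⟨w, hw, rfl⟩
    have hw' : w.length ≤ N := hw
    exact (hlen w).trans (Nat.mul_le_mul (by omega) hw')
  obtain ⟨h1, h2⟩ := hcount ((ℓ + 1) * N)
  have h3 := hg ((ℓ + 1) * N) (Nat.mul_pos (by omega) hN)
  calc _ ≤ _ := Set.ncard_le_ncard hsub h1
    _ ≤ _ := h2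
    _ ≤ s * (c * ((ℓ + 1) * N)) := Nat.mul_le_mul_left _ h3
    _ = _ := by ring

end GraphPart
section TwoEnds

variable {V : Type} {G : SimpleGraph V}

lemma zpow_free (hmove : ∀ a b : V, {φ : G ≃g G | φ a = b}.Finite)
    (g : G ≃g G) (hg : ∀ k, 1 ≤ k → g ^ k ≠ 1) (x : V) (i j : ℤ)
    (h : (g ^ i) x = (g ^ j) x) : i = j := by
  have hinj : Function.Injective (fun n : ℤ => g ^ n) := by
    rw [injective_zpow_iff_not_isOfFinOrder, isOfFinOrder_iff_pow_eq_one]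
    rintro ⟨n, hn, h⟩
    exact hg n hn h
  by_contra hne
  have hfix : (g ^ (i - j)) x = x := by
    rw [sub_eq_neg_add, zpow_add, RelIso.mul_apply, h, ← RelIso.mul_apply, ← zpow_add]
    simp
  have hfixn : ∀ n : ℕ, ((g ^ (i - j)) ^ n) x = x := by
    intro n
    induction n with
    | zero => simp
    | succ n ih => rw [pow_succ, RelIso.mul_apply, hfix, ih]
  have hinf : (Set.range (fun n : ℕ => (g ^ (i - j)) ^ n)).Infinite := by
    apply Set.infinite_range_of_injective
    intro m n hmn
    simp only [← zpow_natCast, ← zpow_mul] at hmn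
    have h2 := hinj hmn
    have h3 : i - j ≠ 0 := sub_ne_zero.2 hne
    exact_mod_cast mul_left_cancel₀ h3 h2
  apply hinf
  refine (hmove x x).subset ?_
  rintro _ ⟨n, rfl⟩
  exact hfixn n

lemma dist_pow_le (hconn : G.Connected) (g : G ≃g G) (v : V) (n : ℕ) :
    G.dist v ((g ^ n) v) ≤ n * G.dist v (g v) := by
  induction n with
  | zero => simp
  | succ n ih =>
    have h1 := hconn.dist_triangle (u := v) (v := (g ^ n) v) (w := (g ^ n) (g v))
    rw [iso_dist hconn] at h1
    rw [pow_succ, RelIso.mul_apply, add_mul, one_mul]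
    omega

/-- an equivariant height function with finite fibres -/
lemma exists_height (hconn : G.Connected)
    (hlf : ∀ v : V, (G.neighborSet v).Finite)
    (v : V) (c : ℕ) (hgr : ∀ n : ℕ, 1 ≤ n → {u : V | G.dist v u ≤ n}.ncard ≤ c * n)
    (g : G ≃g G) (hfree : ∀ (x : V) (i j : ℤ), (g ^ i) x = (g ^ j) x → i = j) :
    ∃ h : V → ℤ, (∀ u, h (g u) = h u + 1) ∧ ∀ i, {u | h u = i}.Finite := by
  let S : Setoid V :=
    { r := fun a b => ∃ i : ℤ, (g ^ i) a = b
      iseqv :=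
        { refl := fun a => ⟨0, by simp⟩
          symm := by
            rintro a _ ⟨i, rfl⟩
            exact ⟨-i, by rw [← RelIso.mul_apply, ← zpow_add]; simp⟩
          trans := by
            rintro a _ _ ⟨i, rfl⟩ ⟨j, rfl⟩
            exact ⟨j + i, by rw [zpow_add, RelIso.mul_apply]⟩ } }
  have hfinQ : Finite (Quotient S) := by
    by_contra hinf
    have : Infinite (Quotient S) := not_finite_iff_infinite.1 hinf
    let ℓ := G.dist v (g v)
    obtain ⟨T, hT⟩ := Infinite.exists_subset_card_eq (Quotient S) (c * ℓ + 1)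
    obtain ⟨D, hD⟩ : ∃ D, ∀ q ∈ T, G.dist v q.out ≤ D := by
      obtain ⟨D, hD⟩ := (T.finite_toSet.image (fun q => G.dist v q.out)).bddAbove
      exact ⟨D, fun q hq => hD ⟨q, hq, rfl⟩⟩
    have hle : ∀ n : ℕ, 1 ≤ n → (n + 1) * (c * ℓ + 1) ≤ c * (n * ℓ + D + 1) := by
      intro n hn
      refine le_trans ?_ (hgr (n * ℓ + D + 1) (by omega))
      rw [← hT, ← Finset.card_range (n + 1), ← Finset.card_product, ← Set.ncard_coe_finset]
      apply Set.ncard_le_ncard_of_injOn (fun p : ℕ × Quotient S => (g ^ p.1) p.2.out)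
        (ht := ball_finite hconn hlf v _)
      · rintro ⟨i, q⟩ hp
        have hp' := Finset.mem_product.1 hp
        have hi : i < n + 1 := Finset.mem_range.1 hp'.1
        have hq := hD q hp'.2
        change G.dist v ((g ^ i) q.out) ≤ _
        have h1 := hconn.dist_triangle (u := v) (v := (g ^ i) v) (w := (g ^ i) q.out)
        rw [iso_dist hconn] at h1
        have h2 := dist_pow_le hconn g v i
        have h3 : i * ℓ ≤ n * ℓ := Nat.mul_le_mul_right _ (by omega)
        change _ ≤ i * ℓ at h2
        omega
      · rintro ⟨i, q⟩ - ⟨j, q'⟩ - h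
        have h' : (g ^ i) q.out = (g ^ j) q'.out := h
        have hq : q = q' := by
          rw [← Quotient.out_eq q, ← Quotient.out_eq q']
          apply Quotient.sound
          refine ⟨-j + i, ?_⟩
          rw [zpow_add, RelIso.mul_apply, zpow_natCast, h', ← zpow_natCast, ← RelIso.mul_apply,
            ← zpow_add]
          simp
        subst hq
        have := hfree q.out i j (by simpa using h')
        simp only [Prod.mk.injEq, and_true]
        exact_mod_cast this
    have h1 := hle (c * (D + 1) + 1) (by omega)
    nlinarith
  have hex : ∀ u, ∃ i : ℤ, (g ^ i) (Quotient.mk S u).out = u := fun u =>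
    Quotient.exact (Quotient.out_eq (Quotient.mk S u))
  choose h hh using hex
  refine ⟨h, fun u => ?_, fun i => ?_⟩
  · have hq : Quotient.mk S (g u) = Quotient.mk S u := (Quotient.sound ⟨1, by simp⟩ :
      Quotient.mk S u = Quotient.mk S (g u)).symm
    have h1 := hh (g u)
    rw [hq] at h1
    apply hfree (Quotient.mk S u).out
    rw [h1, add_comm, zpow_add, RelIso.mul_apply, hh u, zpow_one]
  · refine (Set.finite_range (fun q : Quotient S => (g ^ i) q.out)).subset ?_
    rintro u rfl
    exact ⟨Quotient.mk S u, hh u⟩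

/-- `u` and `w` are joined by a walk in height above `N`. -/
def UpConn (G : SimpleGraph V) (h : V → ℤ) (N : ℤ) (u w : V) : Prop :=
  ∃ p : G.Walk u w, ∀ x ∈ p.support, N < h x

lemma UpConn.trans {h : V → ℤ} {N : ℤ} {a b c : V} (h1 : UpConn G h N a b)
    (h2 : UpConn G h N b c) : UpConn G h N a c := by
  obtain ⟨p, hp⟩ := h1
  obtain ⟨q, hq⟩ := h2
  refine ⟨p.append q, fun x hx => ?_⟩
  rcases (SimpleGraph.Walk.mem_support_append_iff _ _).1 hx with hx | hx
  · exact hp x hx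
  · exact hq x hx

lemma UpConn.symm {h : V → ℤ} {N : ℤ} {a b : V} (h1 : UpConn G h N a b) : UpConn G h N b a := by
  obtain ⟨p, hp⟩ := h1
  exact ⟨p.reverse, fun x hx => hp x (by simpa using hx)⟩

lemma UpConn.mono {h : V → ℤ} {N N' : ℤ} {a b : V} (h1 : UpConn G h N a b) (hN : N' ≤ N) :
    UpConn G h N' a b := by
  obtain ⟨p, hp⟩ := h1
  exact ⟨p, fun x hx => lt_of_le_of_lt hN (hp x hx)⟩

lemma exists_upConn (hconn : G.Connected) (h : V → ℤ) (a b : V) : ∃ N, UpConn G h N a b := by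
  obtain ⟨p⟩ := hconn.preconnected a b
  obtain ⟨N, hN⟩ := ((List.finite_toSet p.support).image h).bddBelow
  exact ⟨N - 1, p, fun x hx => by
    have := hN ⟨x, hx, rfl⟩
    omega⟩

lemma height_zpow {g : G ≃g G} {h : V → ℤ} (hh : ∀ u, h (g u) = h u + 1) (i : ℤ) (u : V) :
    h ((g ^ i) u) = h u + i := by
  induction i using Int.induction_on with
  | zero => simp
  | succ i ih =>
    rw [add_comm (i : ℤ) 1, zpow_add, zpow_one, RelIso.mul_apply, hh, ih]
    ring
  | pred i ih =>
    have h1 := hh ((g ^ (-(i : ℤ) - 1)) u)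
    rw [← RelIso.mul_apply, ← zpow_one_add, show (1 : ℤ) + (-(i : ℤ) - 1) = -i by ring, ih] at h1
    omega

lemma UpConn.shift {g : G ≃g G} {h : V → ℤ} (hh : ∀ u, h (g u) = h u + 1) {N : ℤ} {a b : V}
    (h1 : UpConn G h N a b) (i : ℤ) : UpConn G h (N + i) ((g ^ i) a) ((g ^ i) b) := by
  obtain ⟨p, hp⟩ := h1
  refine ⟨p.map (g ^ i : G ≃g G).toHom, fun x hx => ?_⟩
  rw [SimpleGraph.Walk.support_map] at hx
  obtain ⟨y, hy, rfl⟩ := List.mem_map.1 hx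
  have h2 : h ((g ^ i : G ≃g G).toHom y) = h y + i := height_zpow hh i y
  rw [h2]
  have := hp y hy
  omega

lemma up_connect (hconn : G.Connected) {g : G ≃g G} {h : V → ℤ} (hh : ∀ u, h (g u) = h u + 1)
    (hfib : ∀ i, {u | h u = i}.Finite) :
    ∃ M : ℤ, ∀ N u w, N + M < h u → N + M < h w → UpConn G h N u w := by
  obtain ⟨x⟩ := hconn.nonempty
  choose f hf using fun u => exists_upConn hconn h u x
  obtain ⟨N₁, hN₁⟩ := ((hfib 0).image f).bddBelow
  obtain ⟨N₂, hN₂⟩ := exists_upConn hconn h x (g x)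
  let K := min N₁ N₂
  have hK1 : ∀ u, h u = 0 → UpConn G h K u x := fun u hu =>
    (hf u).mono ((min_le_left _ _).trans (hN₁ ⟨u, hu, rfl⟩))
  have hK2 : UpConn G h K x (g x) := hN₂.mono (min_le_right _ _)
  have hA : ∀ u, UpConn G h (K + h u) u ((g ^ (h u)) x) := by
    intro u
    have h1 := (hK1 ((g ^ (-h u)) u) (by rw [height_zpow hh]; ring)).shift hh (h u)
    rwa [← RelIso.mul_apply, ← zpow_add, add_neg_cancel, zpow_zero, RelIso.one_apply] at h1
  have hB : ∀ (i : ℤ) (n : ℕ), UpConn G h (K + i) ((g ^ i) x) ((g ^ (i + n)) x) := by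
    intro i n
    induction n with
    | zero =>
      have h1 := (hK2.trans hK2.symm).shift hh i
      simpa using h1
    | succ n ih =>
      have h1 := hK2.shift hh (i + n)
      rw [← RelIso.mul_apply, ← zpow_add_one] at h1
      have h2 := ih.trans (h1.mono (by omega))
      rw [show i + ((n + 1 : ℕ) : ℤ) = i + n + 1 by push_cast; ring]
      exact h2
  refine ⟨-K, ?_⟩
  have key : ∀ N u w, N + -K < h u → N + -K < h w → h u ≤ h w → UpConn G h N u w := by
    intro N u w hu hw huw
    obtain ⟨n, hn⟩ := Int.eq_ofNat_of_zero_le (sub_nonneg.2 huw)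
    have h1 := hB (h u) n
    rw [← hn, add_sub_cancel] at h1
    exact ((hA u).mono (by omega)).trans ((h1.mono (by omega)).trans ((hA w).symm.mono (by omega)))
  intro N u w hu hw
  rcases le_total (h u) (h w) with h1 | h1
  · exact key N u w hu hw h1
  · exact (key N w u hw hu h1).symm

/-- loop erasure of an infinite walk going to infinity -/
lemma exists_ray_of_walk {h : V → ℤ} (w : ℕ → V) (hw : ∀ n, G.Adj (w n) (w (n + 1)))
    (hlim : ∀ N : ℤ, ∃ n₀, ∀ n, n₀ ≤ n → N < h (w n)) :
    ∃ r, IsRay G r ∧ ∀ N : ℤ, ∃ n₀, ∀ n, n₀ ≤ n → N < h (r n) := by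
  have hlast : ∀ n, ∃ m, n ≤ m ∧ w m = w n ∧ ∀ k, m < k → w k ≠ w n := by
    intro n
    have hfin : {k | w k = w n}.Finite := by
      obtain ⟨n₀, hn₀⟩ := hlim (h (w n))
      refine (Set.finite_lt_nat n₀).subset ?_
      intro k hk
      by_contra hcon
      have h1 := hn₀ k (not_lt.1 hcon)
      have hk' : w k = w n := hk
      rw [hk'] at h1
      exact lt_irrefl _ h1
    obtain ⟨m, hm, hmax⟩ := hfin.exists_maximal ⟨n, rfl⟩
    refine ⟨m, ?_, hm, ?_⟩
    · by_contra hcon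
      have := hmax (show n ∈ {k | w k = w n} from rfl) (by omega)
      omega
    · intro k hk hkw
      have := hmax (show k ∈ {k | w k = w n} from hkw) hk.le
      omega
  choose last hl1 hl2 hl3 using hlast
  let t : ℕ → ℕ := fun n => Nat.rec 0 (fun _ m => last m + 1) n
  have ht : ∀ n, t (n + 1) = last (t n) + 1 := fun n => rfl
  have hmono : StrictMono t := strictMono_nat_of_lt_succ fun n => by
    rw [ht]; have := hl1 (t n); omega
  have hne : ∀ i j, i < j → w (t j) ≠ w (t i) := by
    intro i j hij
    apply hl3
    have h1 : t (i + 1) ≤ t j := hmono.monotone hij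
    rw [ht] at h1
    omega
  refine ⟨fun n => w (t n), ⟨?_, ?_⟩, ?_⟩
  · intro i j hij
    rcases lt_trichotomy i j with h1 | h1 | h1
    · exact absurd hij.symm (hne i j h1)
    · exact h1
    · exact absurd hij (hne j i h1)
  · intro n
    simp only
    rw [ht, ← hl2 (t n)]
    exact hw _
  · intro N
    obtain ⟨n₀, hn₀⟩ := hlim N
    exact ⟨n₀, fun n hn => hn₀ _ (hn.trans (hmono.id_le n))⟩

lemma exists_up_ray (hconn : G.Connected) {g : G ≃g G} {h : V → ℤ}
    (hh : ∀ u, h (g u) = h u + 1) :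
    ∃ r, IsRay G r ∧ ∀ N : ℤ, ∃ n₀, ∀ n, n₀ ≤ n → N < h (r n) := by
  obtain ⟨x⟩ := hconn.nonempty
  obtain ⟨p⟩ := hconn.preconnected x (g x)
  have hpos : 0 < p.length := by
    rcases Nat.eq_zero_or_pos p.length with h0 | h0
    · have h1 := SimpleGraph.Walk.eq_of_length_eq_zero h0
      have h2 := hh x
      rw [← h1] at h2
      omega
    · exact h0
  obtain ⟨K, hK⟩ := ((List.finite_toSet p.support).image h).bddBelow
  have hK' : ∀ n, K ≤ h (p.getVert n) := fun n => hK ⟨_, p.getVert_mem_support n, rfl⟩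
  let ℓ := p.length
  let w : ℕ → V := fun n => (g ^ (n / ℓ)) (p.getVert (n % ℓ))
  apply exists_ray_of_walk w
  · intro n
    have hlt : n % ℓ < ℓ := Nat.mod_lt _ hpos
    have hadj := p.adj_getVert_succ hlt
    have h1 : G.Adj ((g ^ (n / ℓ)) (p.getVert (n % ℓ))) ((g ^ (n / ℓ)) (p.getVert (n % ℓ + 1))) :=
      (g ^ (n / ℓ) : G ≃g G).map_rel_iff.2 hadj
    have h2 : w (n + 1) = (g ^ (n / ℓ)) (p.getVert (n % ℓ + 1)) := by
      have hdm := Nat.div_add_mod n ℓ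
      rcases Nat.lt_or_ge (n % ℓ + 1) ℓ with h3 | h3
      · have h4 : n + 1 = ℓ * (n / ℓ) + (n % ℓ + 1) := by omega
        have h5 : (n + 1) / ℓ = n / ℓ := by
          rw [h4, Nat.mul_add_div hpos, Nat.div_eq_of_lt h3, add_zero]
        have h6 : (n + 1) % ℓ = n % ℓ + 1 := by
          conv_lhs => rw [h4]
          rw [Nat.mul_add_mod, Nat.mod_eq_of_lt h3]
        simp only [w]
        rw [h5, h6]
      · have h3' : n % ℓ + 1 = ℓ := by omega
        have h4 : n + 1 = ℓ * (n / ℓ + 1) := by rw [mul_add, mul_one]; omega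
        have h5 : (n + 1) / ℓ = n / ℓ + 1 := by
          rw [h4, Nat.mul_div_cancel_left _ hpos]
        have h6 : (n + 1) % ℓ = 0 := by
          rw [h4, Nat.mul_mod_right]
        simp only [w]
        rw [h5, h6, h3', SimpleGraph.Walk.getVert_zero, SimpleGraph.Walk.getVert_length, pow_succ,
          RelIso.mul_apply]
    rw [h2]
    exact h1
  · intro N
    refine ⟨(N - K + 1).toNat * ℓ, fun n hn => ?_⟩
    have h1 : (N - K + 1).toNat ≤ n / ℓ := (Nat.le_div_iff_mul_le hpos).2 hn
    have h2 : h (w n) = h (p.getVert (n % ℓ)) + ((n / ℓ : ℕ) : ℤ) := by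
      simp only [w]
      rw [← zpow_natCast, height_zpow hh]
    rw [h2]
    have h3 := hK' (n % ℓ)
    generalize n / ℓ = q at *
    omega

lemma ray_sign {h : V → ℤ} {m : ℤ} (hm : ∀ a b, G.Adj a b → |h a - h b| ≤ m)
    (r : ℕ → V) (hr : ∀ n, G.Adj (r n) (r (n + 1))) (p : ℕ) (hp : ∀ i, p ≤ i → m < |h (r i)|)
    (hpos : 0 < h (r p)) : ∀ i, p ≤ i → 0 < h (r i) := by
  intro i hi
  induction i, hi using Nat.le_induction with
  | base => exact hpos
  | succ i hi ih =>
    have h1 := abs_le.1 (hm _ _ (hr i))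
    have h2 := hp i hi
    have h3 := hp (i + 1) (by omega)
    rw [abs_of_pos ih] at h2
    rcases lt_abs.1 h3 with h4 | h4 <;> omega

lemma walk_sign {h : V → ℤ} {m : ℤ} (hm : ∀ a b, G.Adj a b → |h a - h b| ≤ m) {a b : V}
    (p : G.Walk a b) (hp : ∀ x ∈ p.support, m < |h x|) (ha : 0 < h a) : 0 < h b := by
  induction p with
  | nil => exact ha
  | @cons a x b hadj q ih =>
    apply ih (fun y hy => hp y (by simp [hy]))
    have h1 := abs_le.1 (hm _ _ hadj)
    have h2 := hp a (by simp)
    have h3 := hp x (by simp)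
    rw [abs_of_pos ha] at h2
    rcases lt_abs.1 h3 with h4 | h4 <;> omega

lemma rayEquiv_of_up (hconn : G.Connected) {g : G ≃g G} {h : V → ℤ}
    (hh : ∀ u, h (g u) = h u + 1) (hfib : ∀ i, {u | h u = i}.Finite)
    (a b : ℕ → V) (ha : ∀ N : ℤ, ∃ n₀, ∀ n, n₀ ≤ n → N < h (a n))
    (hb : ∀ N : ℤ, ∃ n₀, ∀ n, n₀ ≤ n → N < h (b n)) : RayEquiv G a b := by
  intro S hS
  obtain ⟨M, hM⟩ := up_connect hconn hh hfib
  obtain ⟨N, hN⟩ := (hS.image h).bddAbove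
  have hN' : ∀ x, N < h x → x ∉ S := fun x hx hxS => not_lt.2 (hN ⟨x, hxS, rfl⟩) hx
  obtain ⟨p, hp⟩ := ha (max N (N + M))
  obtain ⟨q, hq⟩ := hb (max N (N + M))
  refine ⟨p, q, fun i hi => hN' _ (lt_of_le_of_lt (le_max_left _ _) (hp i hi)),
    fun i hi => hN' _ (lt_of_le_of_lt (le_max_left _ _) (hq i hi)), ?_⟩
  obtain ⟨w, hw⟩ := hM N (a p) (b q) (lt_of_le_of_lt (le_max_right _ _) (hp p le_rfl))
    (lt_of_le_of_lt (le_max_right _ _) (hq q le_rfl))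
  exact ⟨w, fun x hx => hN' x (hw x hx)⟩

lemma two_ends_of_height (hconn : G.Connected) (hlf : ∀ v : V, (G.neighborSet v).Finite)
    {g : G ≃g G} {h : V → ℤ} (hh : ∀ u, h (g u) = h u + 1) (hfib : ∀ i, {u | h u = i}.Finite) :
    ∃ r₁ r₂ : ℕ → V, IsRay G r₁ ∧ IsRay G r₂ ∧ ¬ RayEquiv G r₁ r₂ ∧
      ∀ r, IsRay G r → (RayEquiv G r r₁ ∨ RayEquiv G r r₂) := by
  have hh' : ∀ u, (fun x => -h x) (g⁻¹ u) = (fun x => -h x) u + 1 := by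
    intro u
    have := hh (g⁻¹ u)
    rw [RelIso.apply_inv_self] at this
    simp only
    omega
  have hfib' : ∀ i, {u | (fun x => -h x) u = i}.Finite := by
    intro i
    refine (hfib (-i)).subset ?_
    intro u hu
    have hu' : - h u = i := hu
    change h u = -i
    omega
  have hfibN : ∀ N : ℤ, {u | |h u| ≤ N}.Finite := by
    intro N
    refine ((Set.finite_Icc (-N) N).biUnion fun i _ => hfib i).subset ?_
    intro u hu
    exact Set.mem_iUnion₂.2 ⟨h u, abs_le.1 hu, rfl⟩
  obtain ⟨m, hm⟩ : ∃ m : ℤ, ∀ a b, G.Adj a b → |h a - h b| ≤ m := by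
    have hfin : (⋃ a ∈ {u | h u = 0}, G.neighborSet a).Finite := (hfib 0).biUnion fun a _ => hlf a
    obtain ⟨m, hm⟩ := (hfin.image fun b => |h b|).bddAbove
    refine ⟨m, fun a b hab => ?_⟩
    have h1 : G.Adj ((g ^ (-h a)) a) ((g ^ (-h a)) b) :=
      (g ^ (-h a) : G ≃g G).map_rel_iff.2 hab
    have h2 := hm ⟨(g ^ (-h a)) b, Set.mem_iUnion₂.2 ⟨(g ^ (-h a)) a, ?_, h1⟩, rfl⟩
    · simp only [height_zpow hh] at h2
      rwa [abs_sub_comm, sub_eq_add_neg]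
    · change h _ = 0
      rw [height_zpow hh]; ring
  obtain ⟨r₁, hr₁, hlim₁⟩ := exists_up_ray hconn hh
  obtain ⟨r₂, hr₂, hlim₂⟩ := exists_up_ray (g := g⁻¹) (h := fun x => -h x) hconn hh'
  refine ⟨r₁, r₂, hr₁, hr₂, ?_, ?_⟩
  · intro heq
    obtain ⟨p, q, hp, hq, w, hw⟩ := heq _ (hfibN m)
    have hm' : ∀ a b, G.Adj a b → |(fun x => -h x) a - (fun x => -h x) b| ≤ m := by
      intro a b hab
      have := hm b a hab.symm
      simpa [sub_eq_add_neg, add_comm] using this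
    have hp' : ∀ i, p ≤ i → m < |h (r₁ i)| := fun i hi => not_le.1 (hp i hi)
    have hq' : ∀ i, q ≤ i → m < |h (r₂ i)| := fun i hi => not_le.1 (hq i hi)
    have hw' : ∀ x ∈ w.support, m < |h x| := fun x hx => not_le.1 (hw x hx)
    have hm0 : 0 ≤ m := (abs_nonneg _).trans (hm _ _ (hr₁.2 0))
    have s1 : 0 < h (r₁ p) := by
      by_contra hcon
      have hne : h (r₁ p) ≠ 0 := abs_pos.1 (lt_of_le_of_lt hm0 (hp' p le_rfl))
      have h1 := ray_sign hm' r₁ hr₁.2 p (by simpa using hp') (by omega)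
      obtain ⟨n, hn⟩ := hlim₁ 0
      have h2 := h1 (max n p) (le_max_right _ _)
      have h3 := hn (max n p) (le_max_left _ _)
      omega
    have s2 : 0 < h (r₂ q) := walk_sign hm w hw' s1
    have h1 := ray_sign hm r₂ hr₂.2 q hq' s2
    obtain ⟨n, hn⟩ := hlim₂ 0
    have h2 := h1 (max n q) (le_max_right _ _)
    have h3 := hn (max n q) (le_max_left _ _)
    omega
  · intro r hr
    have habs : ∀ N : ℤ, ∃ n₀, ∀ n, n₀ ≤ n → N < |h (r n)| := by
      intro N
      have hf : (r ⁻¹' {u | |h u| ≤ N}).Finite := (hfibN N).preimage hr.1.injOn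
      obtain ⟨n, hn⟩ := hf.bddAbove
      refine ⟨n + 1, fun k hk => ?_⟩
      by_contra hcon
      have := hn (show k ∈ r ⁻¹' {u | |h u| ≤ N} from not_lt.1 hcon)
      omega
    have hm0 : 0 ≤ m := (abs_nonneg _).trans (hm _ _ (hr.2 0))
    have hm' : ∀ a b, G.Adj a b → |(fun x => -h x) a - (fun x => -h x) b| ≤ m := by
      intro a b hab
      have := hm b a hab.symm
      simpa [sub_eq_add_neg, add_comm] using this
    obtain ⟨p, hp⟩ := habs m
    have hne : h (r p) ≠ 0 := abs_pos.1 (lt_of_le_of_lt hm0 (hp p le_rfl))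
    rcases lt_or_gt_of_ne hne with hs | hs
    · right
      have h1 := ray_sign hm' r hr.2 p (by simpa using hp) (by omega)
      apply rayEquiv_of_up (g := g⁻¹) (h := fun x => -h x) hconn hh' hfib' _ _ _ hlim₂
      intro N
      obtain ⟨n, hn⟩ := habs N
      refine ⟨max n p, fun k hk => ?_⟩
      have h2 := h1 k ((le_max_right _ _).trans hk)
      have h3 := hn k ((le_max_left _ _).trans hk)
      rwa [abs_of_neg (by omega)] at h3
    · left
      have h1 := ray_sign hm r hr.2 p hp hs
      apply rayEquiv_of_up hconn hh hfib _ _ _ hlim₁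
      intro N
      obtain ⟨n, hn⟩ := habs N
      refine ⟨max n p, fun k hk => ?_⟩
      have h2 := h1 k ((le_max_right _ _).trans hk)
      have h3 := hn k ((le_max_left _ _).trans hk)
      rwa [abs_of_pos h2] at h3

end TwoEnds

/-- a locally finite connected graph with linear growth and countably
infinite automorphism group has exactly two ends. -/
theorem linear_growth_countable_aut_two_ends {V : Type} (G : SimpleGraph V)
    (hconn : G.Connected)
    (hlf : ∀ v : V, (G.neighborSet v).Finite)
    (hgrowth : ∃ (v : V) (c : ℕ), ∀ n : ℕ, 1 ≤ n →
      {u : V | G.dist v u ≤ n}.ncard ≤ c * n)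
    (haut : Cardinal.mk (G ≃g G) = Cardinal.aleph0) :
    ∃ r₁ r₂ : ℕ → V, IsRay G r₁ ∧ IsRay G r₂ ∧ ¬ RayEquiv G r₁ r₂ ∧
      ∀ r, IsRay G r → (RayEquiv G r r₁ ∨ RayEquiv G r r₂) := by
  obtain ⟨v, c, hg⟩ := hgrowth
  have hcV : Countable V := by
    rw [← Set.countable_univ_iff]
    have : (Set.univ : Set V) = ⋃ n : ℕ, {u : V | G.dist v u ≤ n} := by
      ext u
      simp only [Set.mem_univ, true_iff]
      exact Set.mem_iUnion.2 ⟨G.dist v u, le_refl (G.dist v u)⟩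
    rw [this]
    exact Set.countable_iUnion fun n => (ball_finite hconn hlf v n).countable
  have hcA : Countable (G ≃g G) := Cardinal.mk_le_aleph0_iff.1 haut.le
  have hiA : Infinite (G ≃g G) := Cardinal.aleph0_le_mk_iff.1 haut.ge
  obtain ⟨F, hF, hbase⟩ := exists_finite_base G
  have hmove := move_finite hconn hlf hF hbase
  have hns := no_finite_support hmove hF hbase
  obtain ⟨g, hgo⟩ := exists_hyperbolic hconn hlf hmove v c hg ((c + 1) ^ (c + 1))
    (fun H _ => finite_subgroup_bound hconn hlf hns hF hbase v c hg H)
  obtain ⟨h, hh, hfib⟩ := exists_height hconn hlf v c hg g (zpow_free hmove g hgo)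
  exact two_ends_of_height hconn hlf hh hfib

end PaperEnds
end

section
/- Let G be a rayless graph and F a finite set of vertices of G. Then the pointwise stabiliser of F in Aut(G) (and hence also the setwise stabiliser of F) is either finite or contains at least 2^{ℵ₀} elements. -/
open Set Cardinal

namespace PaperEnds

/-! ### Components of induced subgraphs -/

/-- The component of `v` in `G[A]` (empty if `v ∉ A`). -/
def Comp {V : Type} (G : SimpleGraph V) (A : Set V) (v : V) : Set V :=
  {u | v ∈ A ∧ Relation.ReflTransGen (fun x y => G.Adj x y ∧ y ∈ A) v u}

section comp

variable {V : Type} {G : SimpleGraph V} {A B : Set V}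

theorem comp_subset {v : V} : Comp G A v ⊆ A := by
  rintro u ⟨hv, h⟩
  induction h with
  | refl => exact hv
  | tail _ h _ => exact h.2

theorem mem_comp_self {v : V} (hv : v ∈ A) : v ∈ Comp G A v := ⟨hv, .refl⟩

theorem comp_step {v x y : V} (hx : x ∈ Comp G A v) (h : G.Adj x y) (hy : y ∈ A) :
    y ∈ Comp G A v := ⟨hx.1, hx.2.tail ⟨h, hy⟩⟩

theorem comp_trans {u v w : V} (h1 : v ∈ Comp G A u) (h2 : w ∈ Comp G A v) : w ∈ Comp G A u :=
  ⟨h1.1, h1.2.trans h2.2⟩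

theorem comp_symm {u v : V} (h : v ∈ Comp G A u) : u ∈ Comp G A v := by
  obtain ⟨hu, h⟩ := h
  induction h with
  | refl => exact mem_comp_self hu
  | @tail b c hb hbc ih =>
    have hbA : b ∈ A := comp_subset (v := u) ⟨hu, hb⟩
    exact comp_trans (comp_step (mem_comp_self hbc.2) hbc.1.symm hbA) ih

theorem comp_eq {u v : V} (h : v ∈ Comp G A u) : Comp G A v = Comp G A u := by
  ext w
  exact ⟨fun hw => comp_trans h hw, fun hw => comp_trans (comp_symm h) hw⟩

theorem comp_mono {v : V} (h : A ⊆ B) : Comp G A v ⊆ Comp G B v := by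
  rintro u ⟨hv, hu⟩
  exact ⟨h hv, Relation.ReflTransGen.mono (fun _ _ h1 => ⟨h1.1, h h1.2⟩) _ _ hu⟩

/-- If two components are not disjoint then they coincide. -/
theorem comp_disjoint {u v : V} (h : Comp G A u ≠ Comp G A v) :
    Disjoint (Comp G A u) (Comp G A v) := by
  rw [Set.disjoint_left]
  intro w h1 h2
  exact h (by rw [← comp_eq h1, comp_eq h2])

theorem comp_induct {v : V} {P : V → Prop} (h0 : v ∈ A → P v)
    (hs : ∀ x y, x ∈ Comp G A v → y ∈ Comp G A v → G.Adj x y → P x → P y)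
    {u : V} (hu : u ∈ Comp G A v) : P u := by
  obtain ⟨hv, h⟩ := hu
  induction h with
  | refl => exact h0 hv
  | @tail b c hb hbc ih =>
    exact hs b c ⟨hv, hb⟩ ⟨hv, hb.tail hbc⟩ hbc.1 ih

theorem comp_sub {P Q R : Set V} {w x : V} (hw : w ∈ Comp G Q x) (hP : P ⊆ Q \ R) :
    Comp G P w ⊆ Comp G (Comp G Q x \ R) w := by
  intro y hy
  refine comp_induct (G := G) (A := P) (v := w)
    (P := fun y => y ∈ Comp G (Comp G Q x \ R) w) ?_ ?_ hy
  · intro h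
    exact mem_comp_self ⟨hw, (hP h).2⟩
  · intro a b _ hb hab ha
    have := hP (comp_subset hb)
    exact comp_step ha hab ⟨comp_step (comp_subset ha).1 hab this.1, this.2⟩

theorem comp_image (φ : G ≃g G) {v : V} : Comp G (φ '' A) (φ v) = φ '' Comp G A v := by
  have key : ∀ (φ : G ≃g G) (A : Set V) (v : V), φ '' Comp G A v ⊆ Comp G (φ '' A) (φ v) := by
    intro φ A v
    rintro _ ⟨u, hu, rfl⟩
    refine comp_induct (P := fun u => φ u ∈ Comp G (φ '' A) (φ v)) ?_ ?_ hu
    · exact fun h => mem_comp_self ⟨v, h, rfl⟩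
    · intro x y _ hy hxy hx
      exact comp_step hx (φ.map_adj_iff.2 hxy) ⟨y, comp_subset hy, rfl⟩
  apply Subset.antisymm
  · intro u hu
    have := key φ⁻¹ (φ '' A) (φ v) ⟨u, hu, rfl⟩
    have e : (φ⁻¹ : G ≃g G) '' (φ '' A) = A := by
      rw [Set.image_image]; simp
    rw [e, RelIso.inv_apply_self] at this
    exact ⟨_, this, RelIso.apply_inv_self _ _⟩
  · exact key φ A v

end comp

/-! ### The rank of a rayless graph -/

/-- `G[W]` has (Schmidt) rank at most `α`. -/
inductive RankLE {V : Type} (G : SimpleGraph V) : Ordinal.{0} → Set V → Prop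
  | mk (α : Ordinal.{0}) (W S : Set V) (hS : S.Finite) (β : V → Ordinal.{0})
      (hβ : ∀ v ∈ W \ S, β v < α) (h : ∀ v ∈ W \ S, RankLE G (β v) (Comp G (W \ S) v)) :
      RankLE G α W

/-- `S` witnesses that `G[W]` has rank at most `α`. -/
def Wit {V : Type} (G : SimpleGraph V) (α : Ordinal.{0}) (W S : Set V) : Prop :=
  S.Finite ∧ ∀ v ∈ W \ S, ∃ β < α, RankLE G β (Comp G (W \ S) v)

section rank

variable {V : Type} {G : SimpleGraph V}

theorem rankLE_iff {α : Ordinal.{0}} {W : Set V} : RankLE G α W ↔ ∃ S, Wit G α W S := by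
  constructor
  · rintro ⟨_, _, S, hS, β, hβ, h⟩
    exact ⟨S, hS, fun v hv => ⟨β v, hβ v hv, h v hv⟩⟩
  · rintro ⟨S, hS, h⟩
    choose! β hβ h using h
    exact .mk α W S hS β hβ h

theorem RankLE.mono {α : Ordinal.{0}} {W W' : Set V} (h : RankLE G α W) (hW : W' ⊆ W) :
    RankLE G α W' := by
  induction h generalizing W' with
  | mk α W S hS β hβ h ih =>
    have hsub : W' \ S ⊆ W \ S := Set.sdiff_subset_sdiff_left hW
    exact .mk α W' S hS β (fun v hv => hβ v (hsub hv))
      (fun v hv => ih v (hsub hv) (comp_mono hsub))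

theorem RankLE.image {α : Ordinal.{0}} {W : Set V} (h : RankLE G α W) (φ : G ≃g G) :
    RankLE G α (φ '' W) := by
  induction h with
  | mk α W S hS β hβ h ih =>
    have e : φ '' W \ φ '' S = φ '' (W \ S) := (Set.image_sdiff φ.injective _ _).symm
    refine .mk α _ (φ '' S) (hS.image _) (fun v => β (φ⁻¹ v)) ?_ ?_
    · rw [e]
      rintro _ ⟨v, hv, rfl⟩
      rw [RelIso.inv_apply_self]
      exact hβ v hv
    · rw [e]
      rintro _ ⟨v, hv, rfl⟩
      rw [RelIso.inv_apply_self, comp_image]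
      exact ih v hv

theorem Wit.image {α : Ordinal.{0}} {W S : Set V} (h : Wit G α W S) (φ : G ≃g G) :
    Wit G α (φ '' W) (φ '' S) := by
  have e : φ '' W \ φ '' S = φ '' (W \ S) := (Set.image_sdiff φ.injective _ _).symm
  refine ⟨h.1.image _, ?_⟩
  rw [e]
  rintro _ ⟨v, hv, rfl⟩
  obtain ⟨β, hβ, h⟩ := h.2 v hv
  exact ⟨β, hβ, by rw [comp_image]; exact h.image φ⟩

theorem Wit.inter {α : Ordinal.{0}} {A S S' : Set V} (h : Wit G α A S) (h' : Wit G α A S') :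
    Wit G α A (S ∩ S') := by
  classical
  refine ⟨h.1.subset Set.inter_subset_left, fun v hv => ?_⟩
  have hD : ∀ x ∈ A \ (S ∩ S'), ∃ (β : Ordinal.{0}) (D T : Set V), β < α ∧ Wit G β D T ∧
      ((D = Comp G (A \ S) x) ∨ (D = Comp G (A \ S') x)) ∧ x ∈ D := by
    rintro x ⟨hxA, hx⟩
    by_cases hxS : x ∈ S
    · have hxS' : x ∉ S' := fun h => hx ⟨hxS, h⟩
      obtain ⟨β, hβ, hr⟩ := h'.2 x ⟨hxA, hxS'⟩
      obtain ⟨T, hT⟩ := rankLE_iff.1 hr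
      exact ⟨β, _, T, hβ, hT, Or.inr rfl, mem_comp_self ⟨hxA, hxS'⟩⟩
    · obtain ⟨β, hβ, hr⟩ := h.2 x ⟨hxA, hxS⟩
      obtain ⟨T, hT⟩ := rankLE_iff.1 hr
      exact ⟨β, _, T, hβ, hT, Or.inl rfl, mem_comp_self ⟨hxA, hxS⟩⟩
  choose! β D T hβ hT hD hxD using hD
  set X : Set V := {x | x ∈ A \ (S ∩ S') ∧ (x = v ∨ x ∈ S ∪ S')} with hX
  have hXfin : X.Finite := by
    refine ((h.1.union h'.1).insert v).subset ?_
    rintro x ⟨_, rfl | hx⟩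
    · exact Set.mem_insert _ _
    · exact Set.mem_insert_of_mem _ hx
  have hvX : v ∈ X := ⟨hv, Or.inl rfl⟩
  obtain ⟨x₀, hx₀, hmax⟩ := Set.exists_max_image X β hXfin ⟨v, hvX⟩
  refine ⟨β x₀, hβ _ hx₀.1, ?_⟩
  -- every vertex of the component is in some `D x`
  have cover : ∀ w ∈ Comp G (A \ (S ∩ S')) v, ∃ x ∈ X, w ∈ D x := by
    intro w hw
    refine comp_induct (P := fun w => ∃ x ∈ X, w ∈ D x) ?_ ?_ hw
    · exact fun _ => ⟨v, hvX, hxD v hv⟩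
    · rintro y z _ hz hyz ⟨x, hxX, hyx⟩
      have hzA := comp_subset hz
      by_cases hzX : z ∈ X
      · exact ⟨z, hzX, hxD z hzA⟩
      · have hzS : z ∉ S ∪ S' := fun h => hzX ⟨hzA, Or.inr h⟩
        refine ⟨x, hxX, ?_⟩
        rcases hD x hxX.1 with e | e
        · rw [e] at hyx ⊢
          exact comp_step hyx hyz ⟨hzA.1, fun h => hzS (Or.inl h)⟩
        · rw [e] at hyx ⊢
          exact comp_step hyx hyz ⟨hzA.1, fun h => hzS (Or.inr h)⟩
  refine rankLE_iff.2 ⟨(S ∪ S') ∪ ⋃ x ∈ X, T x, ?_, ?_⟩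
  · exact (h.1.union h'.1).union (hXfin.biUnion fun x hx => (hT x hx.1).1)
  · rintro w ⟨hwC, hwU⟩
    obtain ⟨x, hxX, hwx⟩ := cover w hwC
    have hwT : w ∉ T x := fun h => hwU (Or.inr (Set.mem_biUnion hxX h))
    obtain ⟨γ, hγ, hr⟩ := (hT x hxX.1).2 w ⟨hwx, hwT⟩
    refine ⟨γ, hγ.trans_le (hmax x hxX), hr.mono ?_⟩
    rcases hD x hxX.1 with e | e
    · rw [e] at hwx ⊢
      refine comp_sub hwx ?_
      rintro z ⟨hzC, hzU⟩
      exact ⟨⟨(comp_subset hzC).1, fun h => hzU (Or.inl (Or.inl h))⟩,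
        fun h => hzU (Or.inr (Set.mem_biUnion hxX h))⟩
    · rw [e] at hwx ⊢
      refine comp_sub hwx ?_
      rintro z ⟨hzC, hzU⟩
      exact ⟨⟨(comp_subset hzC).1, fun h => hzU (Or.inl (Or.inr h))⟩,
        fun h => hzU (Or.inr (Set.mem_biUnion hxX h))⟩

theorem exists_unranked {W S : Set V} (hS : S.Finite) (h : ¬ ∃ α, RankLE G α W) :
    ∃ v ∈ W \ S, ¬ ∃ α, RankLE G α (Comp G (W \ S) v) := by
  by_contra! hc
  choose! β hβ using hc
  exact h ⟨⨆ v, β v + 1, .mk _ W S hS β (fun v _ => Ordinal.lt_iSup_add_one β v) hβ⟩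

/-- Every rayless graph has a rank. -/
theorem exists_rank (hrayless : ¬ ∃ r : ℕ → V, IsRay G r) (W : Set V) :
    ∃ α, RankLE G α W := by
  by_contra hW
  apply hrayless
  -- states: a vertex and an unranked connected set containing it
  let St : Type := {p : V × Set V //
    p.1 ∈ p.2 ∧ p.2 ⊆ Comp G p.2 p.1 ∧ ¬ ∃ α, RankLE G α p.2}
  have step : ∀ p : St, ∃ q : St, q.1.2 ⊆ p.1.2 \ {p.1.1} ∧ G.Adj p.1.1 q.1.1 := by
    rintro ⟨⟨x, C⟩, hx, hC, hr⟩
    obtain ⟨v, hv, hvr⟩ := exists_unranked (Set.finite_singleton x) hr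
    have hvC : v ∈ Comp G C x := hC hv.1
    -- some neighbour of `x` is in the component of `v`
    have : ∃ y ∈ Comp G (C \ {x}) v, G.Adj x y := by
      have hx' : x ∈ Comp G C v := comp_symm hvC
      have := comp_induct (G := G) (A := C) (v := v)
        (P := fun u => (∃ y ∈ Comp G (C \ {x}) v, G.Adj x y) ∨ u ∈ Comp G (C \ {x}) v)
        (fun _ => Or.inr (mem_comp_self hv)) ?_ hx'
      · rcases this with h | h
        · exact h
        · exact absurd rfl (comp_subset h).2
      · rintro a b _ hb hab (h | h)
        · exact Or.inl h
        · by_cases hbx : b = x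
          · subst hbx
            exact Or.inl ⟨a, h, hab.symm⟩
          · exact Or.inr (comp_step h hab ⟨comp_subset hb, hbx⟩)
    obtain ⟨y, hy, hxy⟩ := this
    refine ⟨⟨(y, Comp G (C \ {x}) v), hy, ?_, hvr⟩, comp_subset, hxy⟩
    intro u hu
    have h1 := comp_sub (R := ∅) hy (P := C \ {x}) (by simp)
    rw [Set.sdiff_empty] at h1
    exact h1 (by rw [comp_eq hy]; exact hu)
  choose f hf using step
  obtain ⟨v, hv, hvr⟩ := exists_unranked (S := ∅) Set.finite_empty hW
  let s₀ : St := ⟨(v, Comp G (W \ ∅) v), mem_comp_self hv, by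
    have h1 := comp_sub (R := ∅) (mem_comp_self (G := G) hv) (P := W \ ∅) (by simp)
    rw [Set.sdiff_empty (s := Comp G (W \ ∅) v)] at h1
    exact h1, hvr⟩
  let s : ℕ → St := fun n => f^[n] s₀
  have hs : ∀ n, s (n + 1) = f (s n) := fun n => Function.iterate_succ_apply' f n s₀
  have hanti : Antitone fun n => (s n).1.2 := antitone_nat_of_succ_le fun n => by
    rw [hs]; exact (hf (s n)).1.trans Set.sdiff_subset
  have hne : ∀ m n, m < n → (s m).1.1 ≠ (s n).1.1 := by
    intro m n hmn e
    have h1 : (s n).1.1 ∈ (s (m + 1)).1.2 := hanti hmn (s n).2.1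
    rw [hs] at h1
    exact ((hf (s m)).1 h1).2 e.symm
  refine ⟨fun n => (s n).1.1, ?_, fun n => ?_⟩
  · intro m n e
    rcases lt_trichotomy m n with h | h | h
    · exact absurd e (hne m n h)
    · exact h
    · exact absurd e.symm (hne n m h)
  · change G.Adj (s n).1.1 (s (n + 1)).1.1
    rw [hs]; exact (hf (s n)).2

end rank

/-! ### Automorphisms with prescribed support -/

/-- Automorphisms of `G` that fix every vertex outside `A`. -/
def Fx {V : Type} (G : SimpleGraph V) (A : Set V) : Set (G ≃g G) :=
  {φ | ∀ v, v ∉ A → φ v = v}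

section fx

variable {V : Type} {G : SimpleGraph V} {A B : Set V}

theorem one_mem_fx : (1 : G ≃g G) ∈ Fx G A := fun _ _ => rfl

theorem mul_mem_fx {φ ψ : G ≃g G} (h : φ ∈ Fx G A) (h' : ψ ∈ Fx G A) : φ * ψ ∈ Fx G A := by
  intro v hv
  rw [RelIso.mul_apply, h' v hv, h v hv]

theorem inv_mem_fx {φ : G ≃g G} (h : φ ∈ Fx G A) : φ⁻¹ ∈ Fx G A := by
  intro v hv
  conv_lhs => rw [← h v hv]
  exact RelIso.inv_apply_self _ _

theorem fx_mono (h : A ⊆ B) : Fx G A ⊆ Fx G B := fun _ hφ v hv => hφ v fun hA => hv (h hA)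

theorem fx_maps {φ : G ≃g G} (h : φ ∈ Fx G A) {v : V} (hv : v ∈ A) : φ v ∈ A := by
  by_contra hc
  have := φ.injective (h _ hc)
  rw [this] at hc
  exact hc hv

theorem fx_image {φ : G ≃g G} (h : φ ∈ Fx G A) : φ '' A = A := by
  apply Subset.antisymm
  · rintro _ ⟨v, hv, rfl⟩
    exact fx_maps h hv
  · intro v hv
    exact ⟨φ⁻¹ v, fx_maps (inv_mem_fx h) hv, RelIso.apply_inv_self _ _⟩

theorem fx_comp {φ : G ≃g G} (h : φ ∈ Fx G A) {u v : V} (hu : u ∈ Comp G A v) :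
    φ u ∈ Comp G A (φ v) := by
  have := comp_image (A := A) φ (v := v)
  rw [fx_image h] at this
  rw [this]
  exact ⟨u, hu, rfl⟩

/-- `f` agrees on each component of `G[B]` with an automorphism fixing the complement of `B`. -/
def Loc (G : SimpleGraph V) (B : Set V) (f : V → V) : Prop :=
  (∀ x, x ∉ B → f x = x) ∧ ∀ x ∈ B, ∃ φ ∈ Fx G B, ∀ y ∈ Comp G B x, f y = φ y

theorem Loc.adj {f : V → V} (h : Loc G B f) {x y : V} (hxy : G.Adj x y) :
    G.Adj (f x) (f y) := by
  have key : ∀ {x y : V}, G.Adj x y → x ∈ B → G.Adj (f x) (f y) := by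
    intro x y hxy hx
    obtain ⟨φ, hφ, he⟩ := h.2 x hx
    have h1 : f y = φ y := by
      by_cases hy : y ∈ B
      · exact he y (comp_step (mem_comp_self hx) hxy hy)
      · rw [h.1 y hy, hφ y hy]
    rw [he x (mem_comp_self hx), h1]
    exact φ.map_adj_iff.2 hxy
  by_cases hx : x ∈ B
  · exact key hxy hx
  · by_cases hy : y ∈ B
    · exact (key hxy.symm hy).symm
    · rw [h.1 x hx, h.1 y hy]; exact hxy

theorem exists_aut {f g : V → V} (hf : Loc G B f) (hg : Loc G B g)
    (hgf : Function.LeftInverse g f) (hfg : Function.RightInverse g f) :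
    ∃ φ : G ≃g G, ∀ x, φ x = f x := by
  refine ⟨⟨⟨f, g, hgf, hfg⟩, ?_⟩, fun _ => rfl⟩
  intro a b
  constructor
  · intro h
    have := hg.adj h
    simpa [hgf a, hgf b] using this
  · exact fun h => hf.adj h

/-- The restriction of an automorphism preserving a component. -/
theorem exists_restrict {φ : G ≃g G} (hφ : φ ∈ Fx G B) {v : V}
    (h : φ v ∈ Comp G B v) :
    ∃ γ ∈ Fx G (Comp G B v), ∀ y ∈ Comp G B v, γ y = φ y := by
  classical
  set C := Comp G B v with hC
  have h1 : ∀ ψ ∈ Fx G B, Loc G B (fun x => if x ∈ C then ψ x else x) := by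
    intro ψ hψ
    refine ⟨fun x hx => if_neg fun hc => hx (comp_subset hc), fun x hx => ?_⟩
    by_cases hxC : x ∈ C
    · refine ⟨ψ, hψ, fun y hy => if_pos ?_⟩
      rw [comp_eq hxC] at hy
      exact hy
    · refine ⟨1, one_mem_fx, fun y hy => if_neg fun hc => hxC ?_⟩
      exact comp_trans hc (comp_symm hy)
  have m1 : ∀ x ∈ C, φ x ∈ C := fun x hx => comp_trans h (fx_comp hφ hx)
  have m2 : ∀ x ∈ C, φ⁻¹ x ∈ C := by
    intro x hx
    have h2 := fx_comp (inv_mem_fx hφ) (comp_symm h)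
    rw [RelIso.inv_apply_self] at h2
    have h3 := fx_comp (inv_mem_fx hφ) hx
    exact comp_trans h2 h3
  obtain ⟨γ, hγ⟩ := exists_aut (h1 φ hφ) (h1 φ⁻¹ (inv_mem_fx hφ))
    (by
      intro x
      by_cases hx : x ∈ C
      · simp [hx, m1 x hx]
      · simp [hx])
    (by
      intro x
      by_cases hx : x ∈ C
      · simp [hx, m2 x hx]
      · simp [hx])
  exact ⟨γ, fun x hx => by rw [hγ, if_neg hx], fun x hx => by rw [hγ, if_pos hx]⟩

/-- Swapping a component with its image. -/
theorem exists_swap {φ : G ≃g G} (hφ : φ ∈ Fx G B) {v : V} (hv : v ∈ B)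
    (h : φ v ∉ Comp G B v) :
    ∃ γ ∈ Fx G (Comp G B v ∪ Comp G B (φ v)), γ ≠ 1 := by
  classical
  set C := Comp G B v with hC
  set D := Comp G B (φ v) with hD
  have hCD : Disjoint C D := by
    apply comp_disjoint
    intro e
    apply h
    rw [hC, e]
    exact mem_comp_self (fx_maps hφ hv)
  have hDC : ∀ x ∈ D, x ∉ C := fun x hx hc => Set.disjoint_left.1 hCD hc hx
  have hCD' : ∀ x ∈ C, x ∉ D := fun x hx hc => Set.disjoint_left.1 hCD hx hc
  have m1 : ∀ x ∈ C, φ x ∈ D := fun x hx => fx_comp hφ hx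
  have m2 : ∀ x ∈ D, φ⁻¹ x ∈ C := by
    intro x hx
    have := fx_comp (inv_mem_fx hφ) hx
    rwa [RelIso.inv_apply_self] at this
  let f : V → V := fun x => if x ∈ C then φ x else if x ∈ D then φ⁻¹ x else x
  have hfC : ∀ x ∈ C, f x = φ x := fun x hx => if_pos hx
  have hfD : ∀ x ∈ D, f x = φ⁻¹ x := fun x hx => by simp [f, hDC x hx, hx]
  have hfN : ∀ x, x ∉ C → x ∉ D → f x = x := fun x h1 h2 => by simp [f, h1, h2]
  have hf : Loc G B f := by
    refine ⟨fun x hx => hfN x (fun hc => hx (comp_subset hc)) (fun hc => hx (comp_subset hc)),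
      fun x hx => ?_⟩
    by_cases hxC : x ∈ C
    · refine ⟨φ, hφ, fun y hy => hfC y ?_⟩
      rw [comp_eq hxC] at hy
      exact hy
    · by_cases hxD : x ∈ D
      · refine ⟨φ⁻¹, inv_mem_fx hφ, fun y hy => hfD y ?_⟩
        rw [comp_eq hxD] at hy
        exact hy
      · refine ⟨1, one_mem_fx, fun y hy => hfN y (fun hc => hxC ?_) (fun hc => hxD ?_)⟩
        · exact comp_trans hc (comp_symm hy)
        · exact comp_trans hc (comp_symm hy)
  have hinv : ∀ x, f (f x) = x := by
    intro x
    by_cases hxC : x ∈ C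
    · rw [hfC x hxC, hfD _ (m1 x hxC), RelIso.inv_apply_self]
    · by_cases hxD : x ∈ D
      · rw [hfD x hxD, hfC _ (m2 x hxD), RelIso.apply_inv_self]
      · rw [hfN x hxC hxD, hfN x hxC hxD]
  obtain ⟨γ, hγ⟩ := exists_aut hf hf hinv hinv
  refine ⟨γ, fun x hx => ?_, fun e => ?_⟩
  · rw [hγ, hfN x (fun hc => hx (Or.inl hc)) (fun hc => hx (Or.inr hc))]
  · have h1 := hγ v
    rw [e, hfC v (mem_comp_self hv)] at h1
    apply h
    rw [← h1]
    exact mem_comp_self hv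

/-- Infinitely many disjointly supported automorphisms yield continuum many. -/
theorem continuum_of_seq {D : ℕ → Set V} (hD : ∀ i j, i ≠ j → Disjoint (D i) (D j))
    (hDB : ∀ i, D i ⊆ B) (hcl : ∀ i, ∀ x ∈ D i, Comp G B x ⊆ D i)
    {γ : ℕ → G ≃g G} (hγ : ∀ i, γ i ∈ Fx G (D i)) (hγ1 : ∀ i, γ i ≠ 1) :
    Cardinal.continuum ≤ Cardinal.mk (Fx G B) := by
  classical
  have uniq : ∀ {i j x}, x ∈ D i → x ∈ D j → i = j := by
    intro i j x hi hj
    by_contra hne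
    exact Set.disjoint_left.1 (hD i j hne) hi hj
  have main : ∀ I : Set ℕ, ∃ φ ∈ Fx G B, ∀ i, ∀ x ∈ D i, φ x = if i ∈ I then γ i x else x := by
    intro I
    let F : (ℕ → G ≃g G) → V → V := fun δ x =>
      if h : ∃ i ∈ I, x ∈ D i then δ h.choose x else x
    have F1 : ∀ (δ : ℕ → G ≃g G) i, i ∈ I → ∀ x ∈ D i, F δ x = δ i x := by
      intro δ i hi x hx
      have h : ∃ i ∈ I, x ∈ D i := ⟨i, hi, hx⟩
      have e : h.choose = i := uniq h.choose_spec.2 hx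
      change (if h : ∃ i ∈ I, x ∈ D i then δ h.choose x else x) = _
      rw [dif_pos h, e]
    have F2 : ∀ (δ : ℕ → G ≃g G) x, (¬ ∃ i ∈ I, x ∈ D i) → F δ x = x := fun δ x h => dif_neg h
    have FL : ∀ δ : ℕ → G ≃g G, (∀ i, δ i ∈ Fx G (D i)) → Loc G B (F δ) := by
      intro δ hδ
      refine ⟨fun x hx => F2 δ x ?_, fun x hx => ?_⟩
      · rintro ⟨i, _, hi⟩
        exact hx (hDB i hi)
      · by_cases h : ∃ i ∈ I, x ∈ D i
        · obtain ⟨i, hi, hxi⟩ := h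
          exact ⟨δ i, fx_mono (hDB i) (hδ i), fun y hy => F1 δ i hi y (hcl i x hxi hy)⟩
        · refine ⟨1, one_mem_fx, fun y hy => F2 δ y ?_⟩
          rintro ⟨i, hi, hyi⟩
          exact h ⟨i, hi, hcl i y hyi (comp_symm hy)⟩
    have hγ' : ∀ i, (γ i)⁻¹ ∈ Fx G (D i) := fun i => inv_mem_fx (hγ i)
    let δ : ℕ → G ≃g G := fun i => (γ i)⁻¹
    obtain ⟨φ, hφ⟩ := exists_aut (FL γ hγ) (FL δ hγ')
      (by
        intro x
        by_cases h : ∃ i ∈ I, x ∈ D i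
        · obtain ⟨i, hi, hxi⟩ := h
          rw [F1 γ i hi x hxi, F1 δ i hi _ (fx_maps (hγ i) hxi)]
          exact RelIso.inv_apply_self _ _
        · rw [F2 γ x h, F2 δ x h])
      (by
        intro x
        by_cases h : ∃ i ∈ I, x ∈ D i
        · obtain ⟨i, hi, hxi⟩ := h
          rw [F1 δ i hi x hxi, F1 γ i hi _ (fx_maps (hγ' i) hxi)]
          exact RelIso.apply_inv_self _ _
        · rw [F2 δ x h, F2 γ x h])
    refine ⟨φ, fun x hx => by rw [hφ, (FL γ hγ).1 x hx], fun i x hx => ?_⟩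
    rw [hφ]
    by_cases hi : i ∈ I
    · rw [if_pos hi, F1 γ i hi x hx]
    · rw [if_neg hi]
      refine F2 γ x ?_
      rintro ⟨j, hj, hxj⟩
      exact hi (uniq hx hxj ▸ hj)
  choose Φ hΦ hΦ' using main
  have hinj : Function.Injective fun I : Set ℕ => (⟨Φ I, hΦ I⟩ : Fx G B) := by
    intro I J e
    have e' : Φ I = Φ J := congrArg Subtype.val e
    ext i
    have hmv : ∃ x ∈ D i, γ i x ≠ x := by
      by_contra! hc
      apply hγ1 i
      apply RelIso.ext
      intro x
      by_cases hx : x ∈ D i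
      · exact hc x hx
      · exact hγ i x hx
    obtain ⟨x, hx, hne⟩ := hmv
    have h1 := hΦ' I i x hx
    have h2 := hΦ' J i x hx
    rw [e', h2] at h1
    by_cases hI : i ∈ I
    · by_cases hJ : i ∈ J
      · exact ⟨fun _ => hJ, fun _ => hI⟩
      · rw [if_neg hJ, if_pos hI] at h1
        exact absurd h1.symm hne
    · by_cases hJ : i ∈ J
      · rw [if_pos hJ, if_neg hI] at h1
        exact absurd h1 hne
      · exact ⟨fun h => absurd h hI, fun h => absurd h hJ⟩
  have := Cardinal.mk_le_of_injective hinj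
  rwa [Cardinal.mk_set, Cardinal.mk_nat, Cardinal.two_power_aleph0] at this

/-- Finiteness passes up along finite index. -/
theorem finite_of_agree {H Γ : Set (G ≃g G)} {K : Set V} (hK : K.Finite)
    (hmap : ∀ φ ∈ H, ∀ k ∈ K, φ k ∈ K) (hΓ : Γ.Finite)
    (hag : ∀ φ ∈ H, ∀ ψ ∈ H, (∀ k ∈ K, φ k = ψ k) → ψ⁻¹ * φ ∈ Γ) : H.Finite := by
  have := hK.to_subtype
  refine Set.Finite.of_finite_fibers (fun φ : G ≃g G => fun k : K => φ k) ?_ ?_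
  · refine (Set.Finite.pi (t := fun _ : K => K) fun _ => hK).subset ?_
    rintro _ ⟨φ, hφ, rfl⟩ k _
    exact hmap φ hφ k k.2
  · rintro _ ⟨ψ, hψ, rfl⟩
    refine Set.Finite.of_finite_image (f := fun φ => ψ⁻¹ * φ) (hΓ.subset ?_)
      (mul_right_injective ψ⁻¹).injOn
    rintro _ ⟨φ, ⟨hφ, he⟩, rfl⟩
    exact hag φ hφ ψ hψ fun k hk => congrFun he ⟨k, hk⟩

/-- The dichotomy when all components have finite stabilisers. -/
theorem dichotomy_of_comps (hfin : ∀ v ∈ B, (Fx G (Comp G B v)).Finite) :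
    (Fx G B).Finite ∨ Cardinal.continuum ≤ Cardinal.mk (Fx G B) := by
  classical
  let P : Set V → Prop := fun D => ∃ x ∈ B, ∃ y ∈ B, D = Comp G B x ∪ Comp G B y ∧
    ∃ γ ∈ Fx G D, γ ≠ 1
  have hPcl : ∀ D, P D → ∀ z ∈ D, Comp G B z ⊆ D := by
    rintro _ ⟨x, hx, y, hy, rfl, _⟩ z (hz | hz)
    · rw [comp_eq hz]; exact Set.subset_union_left
    · rw [comp_eq hz]; exact Set.subset_union_right
  by_cases hall : ∀ s : Finset (Set V), (∀ D ∈ s, P D) → ∃ D, P D ∧ ∀ D' ∈ s, Disjoint D' D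
  · right
    obtain ⟨D, hP, hd⟩ := exists_seq_of_forall_finset_exists P (fun a b => Disjoint a b) hall
    have hg : ∀ n, ∃ γ ∈ Fx G (D n), γ ≠ 1 := by
      intro n
      obtain ⟨_, _, _, _, _, h⟩ := hP n
      exact h
    choose γ hγ hγ1 using hg
    refine continuum_of_seq (D := D) ?_ ?_ (fun i => hPcl _ (hP i)) hγ hγ1
    · intro i j hij
      rcases lt_or_gt_of_ne hij with h | h
      · exact hd i j h
      · exact (hd j i h).symm
    · intro i
      obtain ⟨x, _, y, _, e, _⟩ := hP i
      rw [e]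
      exact Set.union_subset comp_subset comp_subset
  left
  push Not at hall
  obtain ⟨s, hs, hno⟩ := hall
  -- a finite set of representatives of the components in `⋃ s`
  obtain ⟨X, hXfin, hXB, hX⟩ : ∃ X : Set V, X.Finite ∧ X ⊆ B ∧
      ∀ D ∈ s, ∀ z ∈ D, ∃ x ∈ X, z ∈ Comp G B x := by
    have hs' : ∀ D ∈ s, ∃ x y, x ∈ B ∧ y ∈ B ∧ D = Comp G B x ∪ Comp G B y := by
      intro D hD
      obtain ⟨x, hx, y, hy, e, _⟩ := hs D hD
      exact ⟨x, y, hx, hy, e⟩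
    choose a b ha hb e using hs'
    refine ⟨Set.range (fun D : s => a D.1 D.2) ∪ Set.range (fun D : s => b D.1 D.2),
      (Set.finite_range _).union (Set.finite_range _), ?_, ?_⟩
    · rintro _ (⟨D, rfl⟩ | ⟨D, rfl⟩)
      · exact ha D.1 D.2
      · exact hb D.1 D.2
    · intro D hD z hz
      rw [e D hD] at hz
      rcases hz with hz | hz
      · exact ⟨a D hD, Or.inl ⟨⟨D, hD⟩, rfl⟩, hz⟩
      · exact ⟨b D hD, Or.inr ⟨⟨D, hD⟩, rfl⟩, hz⟩
  -- no nontrivial move avoids the components of `X`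
  have nomove : ∀ x ∈ B, ∀ y ∈ B, (∀ z ∈ X, x ∉ Comp G B z) → (∀ z ∈ X, y ∉ Comp G B z) →
      ∀ γ ∈ Fx G (Comp G B x ∪ Comp G B y), γ = 1 := by
    intro x hx y hy hxX hyX γ hγ
    by_contra hne
    obtain ⟨D, hD, hnd⟩ := hno (Comp G B x ∪ Comp G B y) ⟨x, hx, y, hy, rfl, γ, hγ, hne⟩
    apply hnd
    rw [Set.disjoint_left]
    rintro w hwD hw
    obtain ⟨z, hz, hwz⟩ := hX D hD w hwD
    rcases hw with hw | hw
    · exact hxX z hz (comp_trans hwz (comp_symm hw))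
    · exact hyX z hz (comp_trans hwz (comp_symm hw))
  have triv : ∀ φ ∈ Fx G B, (∀ x ∈ X, ∀ y ∈ Comp G B x, φ y = y) → φ = 1 := by
    intro φ hφ hφX
    apply RelIso.ext
    intro v
    change φ v = v
    by_contra hne
    have hv : v ∈ B := by
      by_contra hc
      exact hne (hφ v hc)
    have hvX : ∀ z ∈ X, v ∉ Comp G B z := fun z hz hc => hne (hφX z hz v hc)
    have hφvX : ∀ z ∈ X, φ v ∉ Comp G B z := fun z hz hc =>
      hne (φ.injective (hφX z hz _ hc))
    by_cases h : φ v ∈ Comp G B v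
    · obtain ⟨γ, hγ, hγe⟩ := exists_restrict hφ h
      have := nomove v hv v hv hvX hvX γ (fx_mono Set.subset_union_left hγ)
      have h2 := hγe v (mem_comp_self hv)
      rw [this] at h2
      exact hne h2.symm
    · obtain ⟨γ, hγ, hγ1⟩ := exists_swap hφ hv h
      exact hγ1 (nomove v hv _ (fx_maps hφ hv) hvX hφvX γ hγ)
  have orb : ∀ v ∈ B, ((fun φ : G ≃g G => Comp G B (φ v)) '' Fx G B).Finite := by
    intro v hv
    -- at most one translate avoids `X`
    have one : ∀ φ ∈ Fx G B, ∀ ψ ∈ Fx G B, (∀ z ∈ X, φ v ∉ Comp G B z) →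
        (∀ z ∈ X, ψ v ∉ Comp G B z) → Comp G B (φ v) = Comp G B (ψ v) := by
      intro φ hφ ψ hψ h1 h2
      by_contra hne
      have hv1 := fx_maps hφ hv
      have e : (ψ * φ⁻¹) (φ v) = ψ v := by
        rw [RelIso.mul_apply, RelIso.inv_apply_self]
      obtain ⟨γ, hγ, hγ1⟩ := exists_swap (mul_mem_fx hψ (inv_mem_fx hφ)) hv1
        (by
          rw [e]
          intro hc
          exact hne (comp_eq hc).symm)
      rw [e] at hγ
      exact hγ1 (nomove _ hv1 _ (fx_maps hψ hv) h1 h2 γ hγ)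
    by_cases hex : ∃ φ ∈ Fx G B, ∀ z ∈ X, φ v ∉ Comp G B z
    · obtain ⟨ψ, hψ, hψX⟩ := hex
      refine ((hXfin.image (Comp G B)).insert (Comp G B (ψ v))).subset ?_
      rintro _ ⟨φ, hφ, rfl⟩
      by_cases h : ∀ z ∈ X, φ v ∉ Comp G B z
      · exact Or.inl (one φ hφ ψ hψ h hψX)
      · push Not at h
        obtain ⟨z, hz, hc⟩ := h
        exact Or.inr ⟨z, hz, (comp_eq hc).symm⟩
    · push Not at hex
      refine (hXfin.image (Comp G B)).subset ?_
      rintro _ ⟨φ, hφ, rfl⟩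
      obtain ⟨z, hz, hc⟩ := hex φ hφ
      exact ⟨z, hz, (comp_eq hc).symm⟩
  have := hXfin.to_subtype
  refine Set.Finite.of_finite_fibers (fun φ : G ≃g G => fun x : X => Comp G B (φ x)) ?_ ?_
  · refine (Set.Finite.pi fun x : X => orb x (hXB x.2)).subset ?_
    rintro _ ⟨φ, hφ, rfl⟩ x _
    exact ⟨φ, hφ, rfl⟩
  · rintro _ ⟨ψ, hψ, rfl⟩
    have hres : ∀ φ : G ≃g G, ∀ x : X, ∃ γ : G ≃g G,
        (φ ∈ Fx G B ∧ Comp G B (φ x) = Comp G B (ψ x)) →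
        γ ∈ Fx G (Comp G B x) ∧ ∀ y ∈ Comp G B x, γ y = (ψ⁻¹ * φ) y := by
      intro φ x
      by_cases h : φ ∈ Fx G B ∧ Comp G B (φ x) = Comp G B (ψ x)
      · obtain ⟨hφ, he⟩ := h
        have h1 : φ x ∈ Comp G B (ψ x) := he ▸ mem_comp_self (fx_maps hφ (hXB x.2))
        have h2 := fx_comp (inv_mem_fx hψ) h1
        rw [RelIso.inv_apply_self, ← RelIso.mul_apply] at h2
        obtain ⟨γ, h3, h4⟩ := exists_restrict (mul_mem_fx (inv_mem_fx hψ) hφ) h2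
        exact ⟨γ, fun _ => ⟨h3, h4⟩⟩
      · exact ⟨1, fun h' => absurd h' h⟩
    choose R hR using hres
    refine Set.Finite.of_finite_image (f := R)
      ((Set.Finite.pi fun x : X => hfin x (hXB x.2)).subset ?_) ?_
    · rintro _ ⟨φ, ⟨hφ, he⟩, rfl⟩ x _
      exact (hR φ x ⟨hφ, congrFun he x⟩).1
    · rintro φ ⟨hφ, he⟩ φ' ⟨hφ', he'⟩ hRR
      have h1 : φ'⁻¹ * φ = 1 := by
        refine triv _ (mul_mem_fx (inv_mem_fx hφ') hφ) fun x hx y hy => ?_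
        have a1 := (hR φ ⟨x, hx⟩ ⟨hφ, congrFun he ⟨x, hx⟩⟩).2 y hy
        have a2 := (hR φ' ⟨x, hx⟩ ⟨hφ', congrFun he' ⟨x, hx⟩⟩).2 y hy
        rw [hRR, a2, RelIso.mul_apply, RelIso.mul_apply] at a1
        have a3 := (ψ⁻¹).injective a1
        rw [RelIso.mul_apply, ← a3, RelIso.inv_apply_self]
      exact (inv_mul_eq_one.1 h1).symm

/-- The dichotomy for every set of vertices inducing a graph with a rank. -/
theorem dichotomy (α : Ordinal.{0}) : ∀ A : Set V, RankLE G α A →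
    (Fx G A).Finite ∨ Cardinal.continuum ≤ Cardinal.mk (Fx G A) := by
  induction α using WellFoundedLT.induction with
  | ind α ih =>
  intro A hA
  -- a witness of minimal size is invariant
  obtain ⟨K, hK, hmin⟩ : ∃ K, Wit G α A K ∧ ∀ S, Wit G α A S → K.ncard ≤ S.ncard := by
    obtain ⟨S, hS⟩ := rankLE_iff.1 hA
    obtain ⟨K, hK, hm⟩ := exists_minimalFor_of_wellFoundedLT (Wit G α A) Set.ncard ⟨S, hS⟩
    exact ⟨K, hK, fun S hS => (le_total K.ncard S.ncard).elim id fun h => hm hS h⟩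
  have hinv : ∀ φ ∈ Fx G A, ∀ k ∈ K, φ k ∈ K := by
    intro φ hφ
    have h1 : Wit G α A (φ '' K) := by
      have := hK.image φ
      rwa [fx_image hφ] at this
    have h2 := hmin _ (hK.inter h1)
    have h3 : K ∩ φ '' K = K := Set.eq_of_subset_of_ncard_le Set.inter_subset_left h2 hK.1
    have h4 : K ∩ φ '' K = φ '' K := by
      refine Set.eq_of_subset_of_ncard_le Set.inter_subset_right ?_ h1.1
      rw [Set.ncard_image_of_injective _ φ.injective]
      exact h2
    intro k hk
    rw [← h3, h4]
    exact ⟨k, hk, rfl⟩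
  have hsub : Fx G (A \ K) ⊆ Fx G A := fx_mono Set.sdiff_subset
  have hB : (Fx G (A \ K)).Finite ∨ Cardinal.continuum ≤ Cardinal.mk (Fx G (A \ K)) := by
    by_cases hc : ∃ v ∈ A \ K, Cardinal.continuum ≤ Cardinal.mk (Fx G (Comp G (A \ K) v))
    · obtain ⟨v, _, h⟩ := hc
      exact Or.inr (h.trans (Cardinal.mk_le_mk_of_subset (fx_mono comp_subset)))
    · push Not at hc
      refine dichotomy_of_comps fun v hv => ?_
      obtain ⟨β, hβ, hr⟩ := hK.2 v hv
      exact (ih β hβ _ hr).resolve_right (not_le.2 (hc v hv))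
  rcases hB with hB | hB
  · left
    refine finite_of_agree hK.1 hinv hB ?_
    intro φ hφ ψ hψ he v hv
    by_cases hvK : v ∈ K
    · rw [RelIso.mul_apply, he v hvK, RelIso.inv_apply_self]
    · exact mul_mem_fx (inv_mem_fx hψ) hφ v fun h => hv ⟨h, hvK⟩
  · exact Or.inr (hB.trans (Cardinal.mk_le_mk_of_subset hsub))

end fx

/-- in a rayless graph, the pointwise stabiliser (and hence the setwise
stabiliser) of a finite vertex set is finite or of cardinality at least `2^ℵ₀`. -/
theorem rayless_stabiliser_dichotomy {V : Type} (G : SimpleGraph V)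
    (hrayless : ¬ ∃ r : ℕ → V, IsRay G r)
    (F : Set V) (hF : F.Finite) :
    (Finite {φ : G ≃g G | ∀ v ∈ F, φ v = v} ∨
      Cardinal.continuum ≤ Cardinal.mk {φ : G ≃g G | ∀ v ∈ F, φ v = v}) ∧
    (Finite {φ : G ≃g G | ⇑φ '' F = F} ∨
      Cardinal.continuum ≤ Cardinal.mk {φ : G ≃g G | ⇑φ '' F = F}) := by
  obtain ⟨α, hα⟩ := exists_rank hrayless Fᶜ
  have e : {φ : G ≃g G | ∀ v ∈ F, φ v = v} = Fx G Fᶜ := by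
    ext φ
    simp [Fx]
  have hd := dichotomy α Fᶜ hα
  rw [e]
  refine ⟨hd.imp_left fun h => h.to_subtype, ?_⟩
  rcases hd with hd | hd
  · left
    refine Set.Finite.to_subtype (finite_of_agree hF ?_ hd ?_)
    · intro φ hφ k hk
      have h1 : φ '' F = F := hφ
      rw [← h1]
      exact ⟨k, hk, rfl⟩
    · intro φ hφ ψ hψ he v hv
      rw [RelIso.mul_apply, he v (by simpa using hv), RelIso.inv_apply_self]
  · right
    refine hd.trans (Cardinal.mk_le_mk_of_subset ?_)
    intro φ hφ
    change φ '' F = F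
    rw [← e] at hφ
    exact (Set.image_congr hφ).trans (Set.image_id' F)

end PaperEnds
end
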